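/- arXiv:1403.1708 — 6 statements merged into one kernel-verified Lean document; each statement's English description precedes it below -/
import Mathlib

section
/- For every λ > 0 and every nonnegative integer k, the k-th derivative of φ satisfies sup_{x ∈ ℝ} e^{λ|x|} |φ^{(k)}(x)| < ∞; i.e., φ and all its derivatives decay faster than any exponential. -/
open MeasureTheory Real

/-- `φ(x) = (1/(2π)) ∫_ℝ exp(−ω⁴/2) e^{iωx} dω`; since `φ` is real-valued and even,
it equals its cosine-transform expression. -/
noncomputable def phi (x : ℝ) : ℝ :=
  (1 / (2 * Real.pi)) * ∫ ω : ℝ, Real.exp (-(ω ^ 4) / 2) * Real.cos (ω * x)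

/-- The `k`-th `x`-derivative of the integrand `exp (-ζ ^ 4 / 2 + i ζ x)`, as a function of a complex
frequency `ζ`. -/
noncomputable def quarticWave (k : ℕ) (x : ℝ) (ζ : ℂ) : ℂ :=
  (Complex.I * ζ) ^ k * Complex.exp (-ζ ^ 4 / 2 + Complex.I * ζ * x)

lemma norm_exp_quarticPhase (x ω s : ℝ) :
    ‖Complex.exp (-(ω + s * Complex.I : ℂ) ^ 4 / 2 + Complex.I * (ω + s * Complex.I) * x)‖ =
      Real.exp (-(ω ^ 4 - 6 * ω ^ 2 * s ^ 2 + s ^ 4) / 2 - s * x) := by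
  have h : (-(ω + s * Complex.I : ℂ) ^ 4 / 2 + Complex.I * (ω + s * Complex.I) * x) =
      ((-(ω ^ 4 - 6 * ω ^ 2 * s ^ 2 + s ^ 4) / 2 - s * x : ℝ) : ℂ) +
        ((-(4 * ω ^ 3 * s - 4 * ω * s ^ 3) / 2 + ω * x : ℝ) : ℂ) * Complex.I := by
    have h2 : Complex.I ^ 2 = -1 := Complex.I_sq
    have h3 : Complex.I ^ 3 = -Complex.I := Complex.I_pow_three
    have h4 : Complex.I ^ 4 = 1 := Complex.I_pow_four
    push_cast
    ring_nf
    rw [h2, h3, h4]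
    ring
  rw [h, Complex.norm_exp]
  simp only [Complex.add_re, Complex.ofReal_re, Complex.re_ofReal_mul, Complex.I_re, mul_zero,
    add_zero]

lemma norm_quarticWave (k : ℕ) (x ω s : ℝ) :
    ‖quarticWave k x (ω + s * Complex.I)‖ =
      Real.exp (-(s * x)) * ‖quarticWave k 0 (ω + s * Complex.I)‖ := by
  rw [quarticWave, quarticWave, norm_mul, norm_mul, norm_exp_quarticPhase, norm_exp_quarticPhase,
    mul_left_comm, ← Real.exp_add]
  congr 3
  ring

lemma exists_norm_quarticWave_le (k : ℕ) (S X : ℝ) :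
    ∃ C : ℝ, ∀ x ω s : ℝ, |s| ≤ S → |x| ≤ X →
      ‖quarticWave k x (ω + s * Complex.I)‖ ≤ C * Real.exp (-1 * ω ^ 2) := by
  refine ⟨k.factorial * Real.exp (1 + S + S * X + (2 + 3 * S ^ 2) ^ 2 / 2), fun x ω s hs hx ↦ ?_⟩
  have hζ : ‖(ω + s * Complex.I : ℂ)‖ ≤ |ω| + |s| := by
    refine (norm_add_le _ _).trans_eq ?_
    simp
  have hpow : ‖(ω + s * Complex.I : ℂ)‖ ^ k ≤ k.factorial * Real.exp (|ω| + |s|) := by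
    have h := Real.pow_div_factorial_le_exp _ (norm_nonneg (ω + s * Complex.I : ℂ)) k
    rw [div_le_iff₀' (by positivity)] at h
    exact h.trans (by gcongr)
  rw [quarticWave, norm_mul, norm_pow, norm_mul, Complex.norm_I, one_mul, norm_exp_quarticPhase]
  calc _ ≤ k.factorial * Real.exp (|ω| + |s|) *
        Real.exp (-(ω ^ 4 - 6 * ω ^ 2 * s ^ 2 + s ^ 4) / 2 - s * x) := by gcongr
    _ ≤ _ := by
      rw [mul_assoc, mul_assoc _ (Real.exp (1 + _ + _ + _)), ← Real.exp_add, ← Real.exp_add]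
      refine mul_le_mul_of_nonneg_left (Real.exp_le_exp.mpr ?_) (by positivity)
      have hsx : -(s * x) ≤ S * X := by
        refine (neg_le_abs _).trans ?_
        rw [abs_mul]
        exact mul_le_mul hs hx (abs_nonneg _) ((abs_nonneg _).trans hs)
      have hs2 : s ^ 2 ≤ S ^ 2 := sq_le_sq' (abs_le.mp hs).1 (abs_le.mp hs).2
      have hω : |ω| ≤ 1 + ω ^ 2 := by
        rw [← sq_abs]
        nlinarith [sq_nonneg (|ω| - 1)]
      have hωs : ω ^ 2 * s ^ 2 ≤ ω ^ 2 * S ^ 2 := by gcongr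
      nlinarith [sq_nonneg (ω ^ 2 - (2 + 3 * S ^ 2)), sq_nonneg (s ^ 2)]

lemma continuous_quarticWave (k : ℕ) (x : ℝ) : Continuous (quarticWave k x) := by
  unfold quarticWave
  fun_prop

lemma integrable_quarticWave (k : ℕ) (x s : ℝ) :
    Integrable fun ω : ℝ ↦ quarticWave k x (ω + s * Complex.I) := by
  obtain ⟨C, hC⟩ := exists_norm_quarticWave_le k |s| |x|
  refine ((integrable_exp_neg_mul_sq one_pos).const_mul C).mono' ?_
    (.of_forall fun ω ↦ hC x ω s le_rfl le_rfl)
  exact ((continuous_quarticWave k x).comp (by fun_prop)).aestronglyMeasurable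

lemma hasDerivAt_quarticWave_space (k : ℕ) (x : ℝ) (ζ : ℂ) :
    HasDerivAt (fun y ↦ quarticWave k y ζ) (quarticWave (k + 1) x ζ) x := by
  have h : HasDerivAt (fun y : ℝ ↦ -ζ ^ 4 / 2 + Complex.I * ζ * y) (Complex.I * ζ * 1) x :=
    ((Complex.ofRealCLM.hasDerivAt (x := x)).const_mul (Complex.I * ζ)).const_add _
  refine (h.cexp.const_mul ((Complex.I * ζ) ^ k)).congr_deriv ?_
  rw [quarticWave]
  ring

/-- The derivative of `quarticWave k x` with respect to the complex frequency. -/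
noncomputable def quarticWaveDeriv (k : ℕ) (x : ℝ) (ζ : ℂ) : ℂ :=
  k * Complex.I * quarticWave (k - 1) x ζ - 2 * Complex.I * quarticWave (k + 3) x ζ +
    Complex.I * x * quarticWave k x ζ

lemma hasDerivAt_quarticWave (k : ℕ) (x : ℝ) (ζ : ℂ) :
    HasDerivAt (quarticWave k x) (quarticWaveDeriv k x ζ) ζ := by
  have h1 : HasDerivAt (fun z : ℂ ↦ (Complex.I * z) ^ k)
      (k * (Complex.I * ζ) ^ (k - 1) * (Complex.I * 1)) ζ :=
    ((hasDerivAt_id ζ).const_mul Complex.I).pow k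
  have h2 : HasDerivAt (fun z : ℂ ↦ -z ^ 4 / 2 + Complex.I * z * x)
      (-((4 : ℕ) * ζ ^ 3) / 2 + Complex.I * 1 * x) ζ :=
    ((hasDerivAt_pow 4 ζ).neg.div_const 2).add
      (((hasDerivAt_id ζ).const_mul Complex.I).mul_const (x : ℂ))
  refine (h1.mul h2.cexp).congr_deriv ?_
  simp only [quarticWaveDeriv, quarticWave, pow_add, mul_pow _ _ 3, Complex.I_pow_three]
  push_cast
  linear_combination (-2 * (Complex.I * ζ) ^ k * ζ ^ 3 *
    Complex.exp (-ζ ^ 4 / 2 + Complex.I * ζ * x)) * Complex.I_sq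

lemma exists_norm_quarticWaveDeriv_le (k : ℕ) (x S : ℝ) :
    ∃ C : ℝ, ∀ ω s : ℝ, |s| ≤ S →
      ‖quarticWaveDeriv k x (ω + s * Complex.I)‖ ≤ C * Real.exp (-1 * ω ^ 2) := by
  obtain ⟨A, hA⟩ := exists_norm_quarticWave_le (k - 1) S |x|
  obtain ⟨B, hB⟩ := exists_norm_quarticWave_le (k + 3) S |x|
  obtain ⟨D, hD⟩ := exists_norm_quarticWave_le k S |x|
  refine ⟨k * A + 2 * B + |x| * D, fun ω s hs ↦ ?_⟩
  refine (norm_add_le _ _).trans ((add_le_add_left (norm_sub_le _ _) _).trans ?_)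
  simp only [norm_mul, Complex.norm_I, Complex.norm_natCast, Complex.norm_real, Complex.norm_ofNat,
    one_mul, Real.norm_eq_abs, add_mul, mul_assoc]
  gcongr
  · exact hA x ω s hs le_rfl
  · exact hB x ω s hs le_rfl
  · exact hD x ω s hs le_rfl

lemma integrable_quarticWaveDeriv (k : ℕ) (x s : ℝ) :
    Integrable fun ω : ℝ ↦ quarticWaveDeriv k x (ω + s * Complex.I) :=
  (((integrable_quarticWave (k - 1) x s).const_mul _).sub
    ((integrable_quarticWave (k + 3) x s).const_mul _)).add
      ((integrable_quarticWave k x s).const_mul _)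

lemma integral_quarticWaveDeriv (k : ℕ) (x s : ℝ) :
    ∫ ω : ℝ, quarticWaveDeriv k x (ω + s * Complex.I) = 0 := by
  refine integral_eq_zero_of_hasDerivAt_of_integrable (fun ω ↦ ?_)
    (integrable_quarticWaveDeriv k x s) (integrable_quarticWave k x s)
  have h : HasDerivAt (fun y : ℝ ↦ (y + s * Complex.I : ℂ)) 1 ω :=
    (Complex.ofRealCLM.hasDerivAt (x := ω)).add_const _
  simpa [Function.comp_def] using (hasDerivAt_quarticWave k x (ω + s * Complex.I)).comp ω h

/-- Shifting the line of integration does not change the integral. -/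
lemma integral_quarticWave_shift (k : ℕ) (x s : ℝ) :
    ∫ ω : ℝ, quarticWave k x (ω + s * Complex.I) = ∫ ω : ℝ, quarticWave k x ω := by
  have key : ∀ t : ℝ,
      HasDerivAt (fun t : ℝ ↦ ∫ ω : ℝ, quarticWave k x (ω + t * Complex.I)) 0 t := by
    intro t
    obtain ⟨C, hC⟩ := exists_norm_quarticWaveDeriv_le k x (|t| + 1)
    have hd := (hasDerivAt_integral_of_dominated_loc_of_deriv_le (μ := volume)
      (F := fun (t : ℝ) (ω : ℝ) ↦ quarticWave k x (ω + t * Complex.I))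
      (F' := fun (t : ℝ) (ω : ℝ) ↦ quarticWaveDeriv k x (ω + t * Complex.I) * Complex.I)
      (bound := fun ω ↦ C * Real.exp (-1 * ω ^ 2)) (Metric.ball_mem_nhds t one_pos)
      (.of_forall fun t ↦ (integrable_quarticWave k x t).aestronglyMeasurable)
      (integrable_quarticWave k x t)
      ((integrable_quarticWaveDeriv k x t).mul_const _).aestronglyMeasurable
      (.of_forall fun ω r hr ↦ ?_) ((integrable_exp_neg_mul_sq one_pos).const_mul C)
      (.of_forall fun ω r _ ↦ ?_)).2
    · rwa [integral_mul_const, integral_quarticWaveDeriv, zero_mul] at hd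
    · rw [norm_mul, Complex.norm_I, mul_one]
      refine hC ω r ?_
      rw [Metric.mem_ball, Real.dist_eq] at hr
      linarith [abs_sub_abs_le_abs_sub r t]
    · have h : HasDerivAt (fun r : ℝ ↦ (ω + r * Complex.I : ℂ)) Complex.I r := by
        simpa using ((Complex.ofRealCLM.hasDerivAt (x := r)).mul_const Complex.I).const_add (ω : ℂ)
      exact (hasDerivAt_quarticWave k x (ω + r * Complex.I)).comp r h
  simpa using is_const_of_deriv_eq_zero (fun t ↦ (key t).differentiableAt)
    (fun t ↦ (key t).deriv) s 0

lemma hasDerivAt_integral_quarticWave (k : ℕ) (x : ℝ) :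
    HasDerivAt (fun y ↦ ∫ ω : ℝ, quarticWave k y ω) (∫ ω : ℝ, quarticWave (k + 1) x ω) x := by
  obtain ⟨C, hC⟩ := exists_norm_quarticWave_le (k + 1) 0 (|x| + 1)
  have hint (j : ℕ) (y : ℝ) : Integrable fun ω : ℝ ↦ quarticWave j y ω := by
    simpa using integrable_quarticWave j y 0
  refine (hasDerivAt_integral_of_dominated_loc_of_deriv_le (μ := volume)
    (F := fun (y : ℝ) (ω : ℝ) ↦ quarticWave k y ω)
    (F' := fun (y : ℝ) (ω : ℝ) ↦ quarticWave (k + 1) y ω)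
    (bound := fun ω ↦ C * Real.exp (-1 * ω ^ 2)) (Metric.ball_mem_nhds x one_pos)
    (.of_forall fun y ↦ (hint k y).aestronglyMeasurable) (hint k x)
    (hint (k + 1) x).aestronglyMeasurable (.of_forall fun ω y hy ↦ ?_)
    ((integrable_exp_neg_mul_sq one_pos).const_mul C)
    (.of_forall fun ω y _ ↦ hasDerivAt_quarticWave_space k y ω)).2
  rw [Metric.mem_ball, Real.dist_eq] at hy
  simpa using hC y ω 0 (by simp) (by linarith [abs_sub_abs_le_abs_sub y x])

lemma phi_eq_re_integral (x : ℝ) :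
    phi x = 1 / (2 * Real.pi) * (∫ ω : ℝ, quarticWave 0 x ω).re := by
  have hint : Integrable fun ω : ℝ ↦ quarticWave 0 x ω := by
    simpa using integrable_quarticWave 0 x 0
  rw [phi, ← RCLike.re_eq_complex_re, ← integral_re hint]
  congr 2 with ω
  have h : (-(ω : ℂ) ^ 4 / 2 + Complex.I * ω * x) =
      ((-(ω ^ 4) / 2 : ℝ) : ℂ) + ((ω * x : ℝ) : ℂ) * Complex.I := by
    push_cast
    ring
  rw [quarticWave, pow_zero, one_mul, h, RCLike.re_eq_complex_re, Complex.exp_re]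
  simp only [Complex.add_re, Complex.add_im, Complex.ofReal_re, Complex.ofReal_im,
    Complex.re_ofReal_mul, Complex.im_ofReal_mul, Complex.I_re, Complex.I_im, mul_zero, mul_one,
    add_zero, zero_add]

lemma iteratedDeriv_phi (k : ℕ) :
    iteratedDeriv k phi = fun x ↦ 1 / (2 * Real.pi) * (∫ ω : ℝ, quarticWave k x ω).re := by
  induction k with
  | zero => exact iteratedDeriv_zero.trans (funext phi_eq_re_integral)
  | succ k ih =>
    rw [iteratedDeriv_succ, ih]
    funext x
    have h := Complex.reCLM.hasFDerivAt.comp_hasDerivAt x (hasDerivAt_integral_quarticWave k x)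
    exact (h.const_mul (1 / (2 * Real.pi))).deriv

lemma exp_mul_abs_iteratedDeriv_phi_le (k : ℕ) (s x : ℝ) :
    Real.exp (s * x) * |iteratedDeriv k phi x| ≤
      1 / (2 * Real.pi) * ∫ ω : ℝ, ‖quarticWave k 0 (ω + s * Complex.I)‖ := by
  have hbound : |(∫ ω : ℝ, quarticWave k x ω).re| ≤
      Real.exp (-(s * x)) * ∫ ω : ℝ, ‖quarticWave k 0 (ω + s * Complex.I)‖ := by
    rw [← integral_quarticWave_shift k x s, ← integral_const_mul]
    simp_rw [← norm_quarticWave]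
    exact (Complex.abs_re_le_norm _).trans (norm_integral_le_integral_norm _)
  rw [iteratedDeriv_phi, abs_mul, abs_of_pos (by positivity : 0 < 1 / (2 * Real.pi)),
    mul_left_comm]
  gcongr
  calc _ ≤ Real.exp (s * x) *
        (Real.exp (-(s * x)) * ∫ ω : ℝ, ‖quarticWave k 0 (ω + s * Complex.I)‖) := by gcongr
    _ = _ := by rw [← mul_assoc, ← Real.exp_add, add_neg_cancel, Real.exp_zero, one_mul]

/-- For every `λ > 0` and every nonnegative integer `k`,
`sup_{x ∈ ℝ} e^{λ|x|} |φ^{(k)}(x)| < ∞`. -/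
theorem phi_deriv_exp_decay (lam : ℝ) (hlam : 0 < lam) (k : ℕ) :
    ∃ C : ℝ, ∀ x : ℝ, Real.exp (lam * |x|) * |iteratedDeriv k phi x| ≤ C := by
  refine ⟨max (1 / (2 * Real.pi) * ∫ ω : ℝ, ‖quarticWave k 0 (ω + lam * Complex.I)‖)
    (1 / (2 * Real.pi) * ∫ ω : ℝ, ‖quarticWave k 0 (ω + (-lam : ℝ) * Complex.I)‖), fun x ↦ ?_⟩
  rcases abs_cases x with ⟨hx, -⟩ | ⟨hx, -⟩
  · rw [hx]
    exact (exp_mul_abs_iteratedDeriv_phi_le k lam x).trans (le_max_left _ _)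
  · rw [hx, mul_neg, ← neg_mul]
    exact (exp_mul_abs_iteratedDeriv_phi_le k (-lam) x).trans (le_max_right _ _)
end

section
/- For every nonnegative integer k there exists a constant C > 0 such that for all A ≥ 1 and all x ∈ ℝ, |φ^{(k)}(Ax) − φ^{(k)}(x)| ≤ C · ((A−1)/(1+(A−1)|x|)) · |x| e^{−|x|}, and in particular |φ^{(k)}(Ax) − φ^{(k)}(x)| ≤ C · ((A−1)/A) · e^{−|x|}. -/
open MeasureTheory Real

/-- The integrand `(i z)^k exp(-z⁴/2 + i z x)` of the `k`-th derivative of `2π φ`, on the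
horizontal line `z = ω + i η`. -/
noncomputable def phiKernel (k : ℕ) (η x ω : ℝ) : ℂ :=
  (Complex.I * (ω + η * Complex.I)) ^ k *
    Complex.exp (-(ω + η * Complex.I) ^ 4 / 2 + Complex.I * (ω + η * Complex.I) * x)

lemma continuous_phiKernel (k : ℕ) (η x : ℝ) : Continuous (phiKernel k η x) := by
  unfold phiKernel
  fun_prop

/-- Uniform Gaussian domination on horizontal strips. -/
lemma norm_phiKernel_le (k : ℕ) (R : ℝ) :
    ∃ K ≥ (0 : ℝ), ∀ η x ω : ℝ, |η| ≤ R →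
      ‖phiKernel k η x ω‖ ≤ K * Real.exp (-(η * x)) * Real.exp (-1 * ω ^ 2) := by
  refine ⟨k.factorial * Real.exp (R + 1 + (3 * R ^ 2 + 2) ^ 2), by positivity, fun η x ω hη => ?_⟩
  have hre : (-((ω : ℂ) + η * Complex.I) ^ 4 / 2 + Complex.I * (ω + η * Complex.I) * x).re
      = -(ω ^ 4 - 6 * ω ^ 2 * η ^ 2 + η ^ 4) / 2 - η * x := by
    have : -((ω : ℂ) + η * Complex.I) ^ 4 / 2 + Complex.I * (ω + η * Complex.I) * x
        = ((-(ω ^ 4 - 6 * ω ^ 2 * η ^ 2 + η ^ 4) / 2 - η * x : ℝ) : ℂ)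
          + ((-(4 * ω ^ 3 * η - 4 * ω * η ^ 3) / 2 + ω * x : ℝ) : ℂ) * Complex.I := by
      push_cast
      linear_combination (-3 * (ω : ℂ) ^ 2 * η ^ 2 - 2 * ω * η ^ 3 * Complex.I
        - η ^ 4 / 2 * (Complex.I ^ 2 - 1) + η * x) * Complex.I_sq
    rw [this]
    simp only [Complex.add_re, Complex.ofReal_re, Complex.re_ofReal_mul, Complex.I_re, mul_zero,
      add_zero]
  have hz : ‖Complex.I * ((ω : ℂ) + η * Complex.I)‖ ≤ |ω| + R := by
    rw [norm_mul, Complex.norm_I, one_mul]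
    refine (norm_add_le _ _).trans ?_
    simpa using hη
  have hpow : (|ω| + R) ^ k ≤ k.factorial * Real.exp (|ω| + R) := by
    have hR : 0 ≤ |ω| + R := (norm_nonneg _).trans hz
    rw [← div_le_iff₀' (by positivity)]
    exact Real.pow_div_factorial_le_exp _ hR k
  have hexponent : |ω| + R + (-(ω ^ 4 - 6 * ω ^ 2 * η ^ 2 + η ^ 4) / 2 - η * x)
      ≤ R + 1 + (3 * R ^ 2 + 2) ^ 2 + -(η * x) + -1 * ω ^ 2 := by
    have hηR : η ^ 2 ≤ R ^ 2 := sq_le_sq' (neg_le_of_abs_le hη) (le_of_abs_le hη)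
    have h₁ : ω ^ 2 * η ^ 2 ≤ ω ^ 2 * R ^ 2 := by gcongr
    have h₂ : |ω| ≤ 1 + ω ^ 2 := by nlinarith [sq_abs ω, sq_nonneg (|ω| - 1), abs_nonneg ω]
    nlinarith [sq_nonneg (ω ^ 2 - (3 * R ^ 2 + 2)), sq_nonneg (η ^ 2), sq_nonneg (3 * R ^ 2 + 2)]
  rw [phiKernel, norm_mul, norm_pow, Complex.norm_exp, hre]
  calc _ ≤ k.factorial * Real.exp (|ω| + R)
        * Real.exp (-(ω ^ 4 - 6 * ω ^ 2 * η ^ 2 + η ^ 4) / 2 - η * x) := by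
        gcongr
        exact (pow_le_pow_left₀ (norm_nonneg _) hz k).trans hpow
    _ ≤ k.factorial * Real.exp (R + 1 + (3 * R ^ 2 + 2) ^ 2 + -(η * x) + -1 * ω ^ 2) := by
        rw [mul_assoc, ← Real.exp_add]
        gcongr
    _ = _ := by
        rw [Real.exp_add, Real.exp_add]
        ring

lemma integrable_phiKernel (k : ℕ) (η x : ℝ) : Integrable (phiKernel k η x) := by
  obtain ⟨K, -, hK⟩ := norm_phiKernel_le k |η|
  exact ((integrable_exp_neg_mul_sq one_pos).const_mul _).mono'
    (continuous_phiKernel k η x).aestronglyMeasurable (.of_forall fun ω => hK η x ω le_rfl)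

lemma hasDerivAt_phiKernel (k : ℕ) (η x ω : ℝ) :
    HasDerivAt (fun x => phiKernel k η x ω) (phiKernel (k + 1) η x ω) x := by
  have h : HasDerivAt (fun x : ℝ => -((ω : ℂ) + η * Complex.I) ^ 4 / 2
      + Complex.I * (ω + η * Complex.I) * x) (Complex.I * (ω + η * Complex.I)) x := by
    simpa using (Complex.ofRealCLM.hasDerivAt.const_mul
      (Complex.I * (ω + η * Complex.I))).const_add (-((ω : ℂ) + η * Complex.I) ^ 4 / 2)
  refine (h.cexp.const_mul ((Complex.I * (ω + η * Complex.I)) ^ k)).congr_deriv ?_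
  rw [phiKernel]
  ring

lemma hasDerivAt_phiKernel_complex (x : ℝ) (z : ℂ) :
    HasDerivAt (fun z : ℂ => Complex.exp (-z ^ 4 / 2 + Complex.I * z * x))
      ((-2 * z ^ 3 + Complex.I * x) * Complex.exp (-z ^ 4 / 2 + Complex.I * z * x)) z := by
  have h : HasDerivAt (fun z : ℂ => -z ^ 4 / 2 + Complex.I * z * x)
      (-2 * z ^ 3 + Complex.I * x) z := by
    refine ((((hasDerivAt_id z).pow 4).neg.div_const 2).add
      (((hasDerivAt_id z).const_mul Complex.I).mul_const (x : ℂ))).congr_deriv ?_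
    simp
    ring
  exact h.cexp.congr_deriv (mul_comm _ _)

/-- The derivative along the line of the integrand with `k = 0`. -/
noncomputable def phiKernelDeriv (η x ω : ℝ) : ℂ :=
  -2 * Complex.I * phiKernel 3 η x ω + Complex.I * x * phiKernel 0 η x ω

lemma phiKernelDeriv_eq (η x ω : ℝ) :
    phiKernelDeriv η x ω = (-2 * (ω + η * Complex.I) ^ 3 + Complex.I * x) *
      Complex.exp (-(ω + η * Complex.I) ^ 4 / 2 + Complex.I * (ω + η * Complex.I) * x) := by
  have hI : Complex.I * Complex.I ^ 3 = 1 := by rw [← pow_succ', Complex.I_pow_four]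
  simp only [phiKernelDeriv, phiKernel, mul_pow, pow_zero, one_mul]
  linear_combination (-2 * ((ω : ℂ) + η * Complex.I) ^ 3 *
    Complex.exp (-(ω + η * Complex.I) ^ 4 / 2 + Complex.I * (ω + η * Complex.I) * x)) * hI

lemma hasDerivAt_phiKernel_line (η x ω : ℝ) :
    HasDerivAt (phiKernel 0 η x) (phiKernelDeriv η x ω) ω := by
  have h : HasDerivAt (fun ω : ℝ => (ω : ℂ) + η * Complex.I) 1 ω :=
    Complex.ofRealCLM.hasDerivAt.add_const _
  have := (hasDerivAt_phiKernel_complex x _).comp ω h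
  rw [phiKernelDeriv_eq]
  change HasDerivAt (fun ω => phiKernel 0 η x ω) _ ω
  simpa [phiKernel, Function.comp_def] using this

lemma hasDerivAt_phiKernel_height (η x ω : ℝ) :
    HasDerivAt (fun η => phiKernel 0 η x ω) (Complex.I * phiKernelDeriv η x ω) η := by
  have h : HasDerivAt (fun η : ℝ => (ω : ℂ) + η * Complex.I) Complex.I η := by
    simpa using (Complex.ofRealCLM.hasDerivAt.mul_const Complex.I).const_add (ω : ℂ)
  have := (hasDerivAt_phiKernel_complex x _).comp η h
  rw [phiKernelDeriv_eq, mul_comm]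
  simpa [phiKernel, Function.comp_def] using this

lemma integrable_phiKernelDeriv (η x : ℝ) : Integrable (phiKernelDeriv η x) :=
  ((integrable_phiKernel 3 η x).const_mul _).add ((integrable_phiKernel 0 η x).const_mul _)

lemma integral_phiKernelDeriv (η x : ℝ) : ∫ ω, phiKernelDeriv η x ω = 0 :=
  integral_eq_zero_of_hasDerivAt_of_integrable (hasDerivAt_phiKernel_line η x)
    (integrable_phiKernelDeriv η x) (integrable_phiKernel 0 η x)

lemma neg_mul_le_of_abs_le {a b R S : ℝ} (ha : |a| ≤ R) (hb : |b| ≤ S) :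
    -(a * b) ≤ R * S := by
  refine (neg_le_abs _).trans ?_
  rw [abs_mul]
  exact mul_le_mul ha hb (abs_nonneg b) ((abs_nonneg a).trans ha)

lemma abs_le_of_mem_ball_one {a b : ℝ} (h : b ∈ Metric.ball a 1) : |b| ≤ |a| + 1 := by
  rw [Metric.mem_ball, Real.dist_eq] at h
  have := abs_sub_abs_le_abs_sub b a
  linarith

lemma hasDerivAt_integral_phiKernel (k : ℕ) (η x : ℝ) :
    HasDerivAt (fun x => ∫ ω, phiKernel k η x ω) (∫ ω, phiKernel (k + 1) η x ω) x := by
  obtain ⟨K, hK0, hK⟩ := norm_phiKernel_le (k + 1) |η|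
  refine (hasDerivAt_integral_of_dominated_loc_of_deriv_le
    (bound := fun ω => K * Real.exp (|η| * (|x| + 1)) * Real.exp (-1 * ω ^ 2))
    (Metric.ball_mem_nhds x one_pos)
    (.of_forall fun y => (continuous_phiKernel k η y).aestronglyMeasurable)
    (integrable_phiKernel k η x) (continuous_phiKernel (k + 1) η x).aestronglyMeasurable
    (.of_forall fun ω y hy => (hK η y ω le_rfl).trans ?_)
    ((integrable_exp_neg_mul_sq one_pos).const_mul _)
    (.of_forall fun ω y _ => hasDerivAt_phiKernel k η y ω)).2
  gcongr
  exact neg_mul_le_of_abs_le le_rfl (abs_le_of_mem_ball_one hy)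

lemma hasDerivAt_integral_phiKernel_height (η x : ℝ) :
    HasDerivAt (fun η => ∫ ω, phiKernel 0 η x ω) 0 η := by
  obtain ⟨K₀, hK₀0, hK₀⟩ := norm_phiKernel_le 0 (|η| + 1)
  obtain ⟨K₃, hK₃0, hK₃⟩ := norm_phiKernel_le 3 (|η| + 1)
  refine (hasDerivAt_integral_of_dominated_loc_of_deriv_le
    (bound := fun ω => (2 * K₃ + |x| * K₀) * Real.exp ((|η| + 1) * |x|) * Real.exp (-1 * ω ^ 2))
    (Metric.ball_mem_nhds η one_pos)
    (.of_forall fun y => (continuous_phiKernel 0 y x).aestronglyMeasurable)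
    (integrable_phiKernel 0 η x)
    ((integrable_phiKernelDeriv η x).const_mul Complex.I).aestronglyMeasurable
    (.of_forall fun ω y hy => ?_)
    ((integrable_exp_neg_mul_sq one_pos).const_mul _)
    (.of_forall fun ω y _ => hasDerivAt_phiKernel_height y x ω)).2.congr_deriv ?_
  · have hy' := abs_le_of_mem_ball_one hy
    have hmul := neg_mul_le_of_abs_le hy' (le_refl |x|)
    calc ‖Complex.I * phiKernelDeriv y x ω‖
        ≤ 2 * ‖phiKernel 3 y x ω‖ + |x| * ‖phiKernel 0 y x ω‖ := by
          rw [norm_mul, Complex.norm_I, one_mul]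
          refine (norm_add_le _ _).trans_eq ?_
          simp
      _ ≤ 2 * (K₃ * Real.exp ((|η| + 1) * |x|) * Real.exp (-1 * ω ^ 2))
          + |x| * (K₀ * Real.exp ((|η| + 1) * |x|) * Real.exp (-1 * ω ^ 2)) := by
          gcongr
          · exact (hK₃ y x ω hy').trans (by gcongr)
          · exact (hK₀ y x ω hy').trans (by gcongr)
      _ = _ := by ring
  · rw [integral_const_mul, integral_phiKernelDeriv, mul_zero]

/-- Shifting the line of integration does not change the integral. -/
lemma integral_phiKernel_eq (k : ℕ) (η x : ℝ) :
    ∫ ω, phiKernel k η x ω = ∫ ω, phiKernel k 0 x ω := by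
  induction k generalizing x with
  | zero =>
    exact is_const_of_deriv_eq_zero
      (fun η => (hasDerivAt_integral_phiKernel_height η x).differentiableAt)
      (fun η => (hasDerivAt_integral_phiKernel_height η x).deriv) η 0
  | succ k ih =>
    rw [← (hasDerivAt_integral_phiKernel k η x).deriv,
      ← (hasDerivAt_integral_phiKernel k 0 x).deriv]
    simp only [ih]

lemma phi_eq_re (x : ℝ) : phi x = 1 / (2 * Real.pi) * (∫ ω, phiKernel 0 0 x ω).re := by
  rw [phi, ← Complex.reCLM_apply, ← Complex.reCLM.integral_comp_comm (integrable_phiKernel 0 0 x)]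
  congr 2 with ω
  have : -((ω : ℂ)) ^ 4 / 2 + Complex.I * ω * x
      = ((-(ω ^ 4) / 2 : ℝ) : ℂ) + ((ω * x : ℝ) : ℂ) * Complex.I := by
    push_cast
    ring
  simp only [phiKernel, pow_zero, one_mul, Complex.ofReal_zero, zero_mul, add_zero, this,
    Complex.reCLM_apply, Complex.exp_re, Complex.add_re, Complex.add_im, Complex.ofReal_re,
    Complex.ofReal_im, Complex.re_ofReal_mul, Complex.im_ofReal_mul, Complex.I_re, Complex.I_im,
    mul_zero, mul_one, zero_add]

lemma iteratedDeriv_phi_eq_re (k : ℕ) :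
    iteratedDeriv k phi = fun x => 1 / (2 * Real.pi) * (∫ ω, phiKernel k 0 x ω).re := by
  induction k with
  | zero => exact funext fun x => by rw [iteratedDeriv_zero, phi_eq_re]
  | succ k ih =>
    funext x
    rw [iteratedDeriv_succ, ih]
    exact ((Complex.reCLM.hasFDerivAt.comp_hasDerivAt x
      (hasDerivAt_integral_phiKernel k 0 x)).const_mul _).deriv

lemma hasDerivAt_iteratedDeriv_phi (k : ℕ) (x : ℝ) :
    HasDerivAt (iteratedDeriv k phi) (iteratedDeriv (k + 1) phi x) x := by
  rw [iteratedDeriv_phi_eq_re k, iteratedDeriv_phi_eq_re (k + 1)]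
  exact (Complex.reCLM.hasFDerivAt.comp_hasDerivAt x
    (hasDerivAt_integral_phiKernel k 0 x)).const_mul _

lemma abs_iteratedDeriv_phi_le (k : ℕ) {R : ℝ} (hR : 0 ≤ R) :
    ∃ M ≥ (0 : ℝ), ∀ x, |iteratedDeriv k phi x| ≤ M * Real.exp (-(R * |x|)) := by
  obtain ⟨K, hK0, hK⟩ := norm_phiKernel_le k R
  refine ⟨1 / (2 * Real.pi) * (K * ∫ ω : ℝ, Real.exp (-1 * ω ^ 2)), by positivity, fun x => ?_⟩
  obtain ⟨η, hη, hηx⟩ : ∃ η : ℝ, |η| ≤ R ∧ η * x = R * |x| := by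
    rcases le_total 0 x with hx | hx
    · exact ⟨R, (abs_of_nonneg hR).le, by rw [abs_of_nonneg hx]⟩
    · exact ⟨-R, by rw [abs_neg, abs_of_nonneg hR], by rw [abs_of_nonpos hx]; ring⟩
  simp only [iteratedDeriv_phi_eq_re, ← integral_phiKernel_eq k η x]
  rw [abs_mul, abs_of_nonneg (by positivity : 0 ≤ 1 / (2 * Real.pi)), mul_assoc]
  gcongr
  calc |(∫ ω, phiKernel k η x ω).re| ≤ ‖∫ ω, phiKernel k η x ω‖ := Complex.abs_re_le_norm _
    _ ≤ ∫ ω : ℝ, K * Real.exp (-(η * x)) * Real.exp (-1 * ω ^ 2) :=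
        norm_integral_le_of_norm_le ((integrable_exp_neg_mul_sq one_pos).const_mul _)
          (.of_forall fun ω => hK η x ω hη)
    _ = _ := by rw [integral_const_mul, hηx]; ring

/-- The dilation estimate for a function decaying like `exp(-2|x|)` along with its derivative. -/
lemma abs_dilation_sub_le {f f' : ℝ → ℝ} {M : ℝ} (hf : ∀ x, HasDerivAt f (f' x) x)
    (hM : ∀ x, |f x| ≤ M * Real.exp (-(2 * |x|)))
    (hM' : ∀ x, |f' x| ≤ M * Real.exp (-(2 * |x|))) {A : ℝ} (hA : 1 ≤ A) (x : ℝ) :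
    |f (A * x) - f x| ≤
      4 * M * ((A - 1) * |x| / (1 + (A - 1) * |x|)) * Real.exp (-(2 * |x|)) := by
  have hM0 : 0 ≤ M := by simpa using (abs_nonneg _).trans (hM 0)
  set E := Real.exp (-(2 * |x|)) with hE
  set t := (A - 1) * |x| with ht
  have ht0 : 0 ≤ t := mul_nonneg (by linarith) (abs_nonneg x)
  have hdecay : ∀ B : ℝ, 1 ≤ B → M * Real.exp (-(2 * |B * x|)) ≤ M * E := fun B hB => by
    have : |x| ≤ |B * x| := by
      rw [abs_mul, abs_of_nonneg (by linarith : 0 ≤ B)]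
      exact le_mul_of_one_le_left (abs_nonneg x) hB
    rw [hE]
    gcongr
  have hsmall : |f (A * x) - f x| ≤ M * E * t := by
    have h := norm_image_sub_le_of_norm_deriv_le_segment'
      (f := fun B => f (B * x)) (f' := fun B => f' (B * x) * x) (C := M * E * |x|) (a := 1) (b := A)
      (fun B _ => ((hf (B * x)).comp B (hasDerivAt_mul_const x)).hasDerivWithinAt)
      (fun B hB => by
        rw [norm_mul, Real.norm_eq_abs, Real.norm_eq_abs]
        gcongr
        exact (hM' _).trans (hdecay B hB.1)) A (Set.right_mem_Icc.2 hA)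
    rw [one_mul, Real.norm_eq_abs] at h
    exact h.trans_eq (by rw [ht]; ring)
  have hlarge : |f (A * x) - f x| ≤ M * E * 2 := by
    have := (hM (A * x)).trans (hdecay A hA)
    have := abs_sub (f (A * x)) (f x)
    have := hM x
    linarith
  have hME : 0 ≤ M * E := by positivity
  have hquot : min t 2 ≤ 4 * (t / (1 + t)) := by
    rw [← mul_div_assoc, le_div_iff₀ (by linarith)]
    rcases le_total t 2 with h | h
    · rw [min_eq_left h]
      nlinarith
    · rw [min_eq_right h]
      linarith
  calc |f (A * x) - f x| ≤ M * E * min t 2 := by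
        rw [mul_min_of_nonneg _ _ hME]
        exact le_min hsmall hlarge
    _ ≤ M * E * (4 * (t / (1 + t))) := by gcongr
    _ = _ := by ring

lemma dilation_quotient_le {A : ℝ} (hA : 1 ≤ A) {y : ℝ} (hy : 0 ≤ y) :
    (A - 1) * y / (1 + (A - 1) * y) ≤ (A - 1) / A * Real.exp y := by
  have ht : 0 ≤ (A - 1) * y := mul_nonneg (by linarith) hy
  have hexp := Real.add_one_le_exp y
  refine le_trans ?_ (mul_le_mul_of_nonneg_left hexp (div_nonneg (by linarith) (by linarith)))
  rw [div_mul_eq_mul_div, div_le_div_iff₀ (by linarith) (by linarith)]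
  have : 0 ≤ (A - 1) * (1 + (A - 1) * y ^ 2) := by
    have : 0 ≤ A - 1 := by linarith
    positivity
  nlinarith

/-- For every `k` there is `C > 0` such that for all `A ≥ 1` and `x ∈ ℝ`,
`|φ^{(k)}(Ax) − φ^{(k)}(x)| ≤ C ((A−1)/(1+(A−1)|x|)) |x| e^{−|x|}`, and in particular
`|φ^{(k)}(Ax) − φ^{(k)}(x)| ≤ C ((A−1)/A) e^{−|x|}`. -/
theorem phi_deriv_dilation_bound (k : ℕ) :
    ∃ C > (0 : ℝ), ∀ A : ℝ, 1 ≤ A → ∀ x : ℝ,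
      |iteratedDeriv k phi (A * x) - iteratedDeriv k phi x| ≤
        C * ((A - 1) / (1 + (A - 1) * |x|)) * (|x| * Real.exp (-|x|)) ∧
      |iteratedDeriv k phi (A * x) - iteratedDeriv k phi x| ≤
        C * ((A - 1) / A) * Real.exp (-|x|) := by
  obtain ⟨M₀, hM₀, h₀⟩ := abs_iteratedDeriv_phi_le k zero_le_two
  obtain ⟨M₁, hM₁, h₁⟩ := abs_iteratedDeriv_phi_le (k + 1) zero_le_two
  refine ⟨4 * (M₀ + M₁ + 1), by positivity, fun A hA x => ?_⟩
  have key := abs_dilation_sub_le (M := M₀ + M₁ + 1) (hasDerivAt_iteratedDeriv_phi k)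
    (fun y => (h₀ y).trans (by gcongr; linarith)) (fun y => (h₁ y).trans (by gcongr; linarith)) hA x
  have hA' : 0 ≤ A - 1 := by linarith
  constructor
  · calc _ ≤ _ := key
      _ ≤ 4 * (M₀ + M₁ + 1) * ((A - 1) * |x| / (1 + (A - 1) * |x|)) * Real.exp (-|x|) := by
          gcongr
          linarith [abs_nonneg x]
      _ = _ := by ring
  · calc _ ≤ _ := key
      _ ≤ 4 * (M₀ + M₁ + 1) * ((A - 1) / A * Real.exp |x|) * Real.exp (-(2 * |x|)) := by
          gcongr
          exact dilation_quotient_le hA (abs_nonneg x)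
      _ = 4 * (M₀ + M₁ + 1) * ((A - 1) / A) * (Real.exp |x| * Real.exp (-(2 * |x|))) := by ring
      _ = _ := by
          rw [← Real.exp_add]
          ring_nf
end

section
/- There exists a constant C > 0 such that for all x ∈ ℝ and all H > 0, the second derivative of φ satisfies |φ''(x+H) − φ''(x)| ≤ C (H² + H|x|) / (1 + H² + H|x|). -/
open MeasureTheory Real

lemma integrable_pow_mul_exp_neg_pow_four (n : ℕ) :
    Integrable fun ω : ℝ => ω ^ n * exp (-(ω ^ 4) / 2) := by
  have h : Integrable fun ω : ℝ => ω ^ (n : ℝ) * exp (-1 * ω ^ 2) :=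
    integrable_rpow_mul_exp_neg_mul_sq one_pos (by linarith [n.cast_nonneg (α := ℝ)])
  refine (h.const_mul (exp (1 / 2))).mono (by fun_prop) (ae_of_all _ fun ω => ?_)
  simp only [rpow_natCast, norm_mul, norm_eq_abs, abs_exp]
  rw [mul_left_comm, ← exp_add]
  gcongr
  nlinarith [sq_nonneg (ω ^ 2 - 1)]

lemma integrable_pow_mul_exp_neg_pow_four_mul (n : ℕ) {f : ℝ → ℝ} (hf : Continuous f)
    (hb : ∀ t, |f t| ≤ 1) (x : ℝ) :
    Integrable fun ω : ℝ => ω ^ n * exp (-(ω ^ 4) / 2) * f (ω * x) :=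
  (integrable_pow_mul_exp_neg_pow_four n).mul_bdd (c := 1) (by fun_prop)
    (ae_of_all _ fun ω => hb _)

/-- Differentiation under the integral sign against the weight `ω ^ n * exp (-ω ^ 4 / 2)`. -/
lemma hasDerivAt_integral_pow_mul_exp_neg_pow_four_mul (n : ℕ) {f f' : ℝ → ℝ}
    (hf : ∀ t, HasDerivAt f (f' t) t) (hf' : Continuous f')
    (hb : ∀ t, |f t| ≤ 1) (hb' : ∀ t, |f' t| ≤ 1) (x : ℝ) :
    HasDerivAt (fun x => ∫ ω : ℝ, ω ^ n * exp (-(ω ^ 4) / 2) * f (ω * x))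
      (∫ ω : ℝ, ω ^ (n + 1) * exp (-(ω ^ 4) / 2) * f' (ω * x)) x := by
  have hc : Continuous f := continuous_iff_continuousAt.2 fun t => (hf t).continuousAt
  refine (hasDerivAt_integral_of_dominated_loc_of_deriv_le (s := Set.univ)
    (bound := fun ω => |ω ^ (n + 1) * exp (-(ω ^ 4) / 2)|)
    (F' := fun y ω => ω ^ (n + 1) * exp (-(ω ^ 4) / 2) * f' (ω * y))
    Filter.univ_mem (.of_forall fun y => by fun_prop)
    (integrable_pow_mul_exp_neg_pow_four_mul n hc hb x) (by fun_prop)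
    (ae_of_all _ fun ω y _ => ?_) (integrable_pow_mul_exp_neg_pow_four (n + 1)).abs
    (ae_of_all _ fun ω y _ => ?_)).2
  · rw [norm_mul]
    exact mul_le_of_le_one_right (norm_nonneg _) (hb' _)
  · refine (((hf (ω * y)).comp y ((hasDerivAt_id y).const_mul ω)).const_mul
      (ω ^ n * exp (-(ω ^ 4) / 2))).congr_deriv ?_
    ring

lemma iteratedDeriv_two_phi (x : ℝ) :
    iteratedDeriv 2 phi x =
      1 / (2 * π) * ∫ ω : ℝ, ω ^ 2 * exp (-(ω ^ 4) / 2) * -cos (ω * x) := by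
  have h1 : deriv phi = fun x =>
      1 / (2 * π) * ∫ ω : ℝ, ω ^ 1 * exp (-(ω ^ 4) / 2) * -sin (ω * x) := by
    funext y
    have h := (hasDerivAt_integral_pow_mul_exp_neg_pow_four_mul 0 hasDerivAt_cos
      continuous_sin.neg abs_cos_le_one (by simpa using abs_sin_le_one) y).const_mul (1 / (2 * π))
    simp only [pow_zero, one_mul] at h
    exact h.deriv
  rw [iteratedDeriv_succ, iteratedDeriv_one, h1]
  exact ((hasDerivAt_integral_pow_mul_exp_neg_pow_four_mul 1 (fun t => (hasDerivAt_sin t).neg)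
    continuous_cos.neg (by simpa using abs_sin_le_one) (by simpa using abs_cos_le_one) x).const_mul
    (1 / (2 * π))).deriv

lemma abs_cos_mul_sub_cos_mul_le (ω x : ℝ) {H : ℝ} (hH : 0 < H) :
    |-cos (ω * (x + H)) - -cos (ω * x)| ≤
      (ω ^ 2 + 2) * ((H ^ 2 + H * |x|) / (1 + H ^ 2 + H * |x|)) := by
  have hA : 0 ≤ H ^ 2 + H * |x| := by positivity
  have h2 : |-cos (ω * (x + H)) - -cos (ω * x)| ≤ 2 := by
    rw [abs_le]
    constructor <;> linarith [neg_one_le_cos (ω * (x + H)), cos_le_one (ω * (x + H)),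
      neg_one_le_cos (ω * x), cos_le_one (ω * x)]
  have hω : |-cos (ω * (x + H)) - -cos (ω * x)| ≤ ω ^ 2 * (H ^ 2 + H * |x|) := by
    have e : -cos (ω * (x + H)) - -cos (ω * x) =
        2 * (sin (ω * (x + H / 2)) * sin (ω * (H / 2))) := by
      rw [show ω * (x + H) = ω * (x + H / 2) + ω * (H / 2) by ring,
        show ω * x = ω * (x + H / 2) - ω * (H / 2) by ring, cos_add, cos_sub]
      ring
    have hx : |x + H / 2| ≤ |x| + H := by
      have := abs_add_le x (H / 2)
      rw [abs_of_pos (half_pos hH)] at this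
      linarith
    calc |-cos (ω * (x + H)) - -cos (ω * x)|
        = 2 * (|sin (ω * (x + H / 2))| * |sin (ω * (H / 2))|) := by
          rw [e, abs_mul, abs_mul, abs_two]
      _ ≤ 2 * (|ω * (x + H / 2)| * |ω * (H / 2)|) := by
          gcongr 2 * (?_ * ?_) <;> exact abs_sin_le_abs
      _ = |ω| ^ 2 * (|x + H / 2| * H) := by
          rw [abs_mul, abs_mul, abs_of_pos (half_pos hH)]
          ring
      _ ≤ |ω| ^ 2 * ((|x| + H) * H) := by gcongr
      _ = ω ^ 2 * (H ^ 2 + H * |x|) := by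
          rw [sq_abs]
          ring
  rw [← mul_div_assoc, le_div_iff₀ (by linarith)]
  nlinarith [mul_le_mul_of_nonneg_right h2 hA]

/-- There is `C > 0` such that for all `x ∈ ℝ` and `H > 0`,
`|φ''(x+H) − φ''(x)| ≤ C (H² + H|x|) / (1 + H² + H|x|)`. -/
theorem phi_second_deriv_increment_bound :
    ∃ C > (0 : ℝ), ∀ x H : ℝ, 0 < H →
      |iteratedDeriv 2 phi (x + H) - iteratedDeriv 2 phi x| ≤
        C * (H ^ 2 + H * |x|) / (1 + H ^ 2 + H * |x|) := by
  have hint : Integrable fun ω : ℝ => ω ^ 2 * exp (-(ω ^ 4) / 2) * (ω ^ 2 + 2) := by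
    refine ((integrable_pow_mul_exp_neg_pow_four 4).add
      ((integrable_pow_mul_exp_neg_pow_four 2).const_mul 2)).congr (ae_of_all _ fun ω => ?_)
    simp only [Pi.add_apply]
    ring
  have hM : 0 ≤ ∫ ω : ℝ, ω ^ 2 * exp (-(ω ^ 4) / 2) * (ω ^ 2 + 2) :=
    integral_nonneg fun ω => by positivity
  refine ⟨1 / (2 * π) * (∫ ω : ℝ, ω ^ 2 * exp (-(ω ^ 4) / 2) * (ω ^ 2 + 2)) + 1,
    by positivity, fun x H hH => ?_⟩
  have hcos (y : ℝ) := integrable_pow_mul_exp_neg_pow_four_mul 2 (f := fun t => -cos t)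
    continuous_cos.neg (by simpa using abs_cos_le_one) y
  set r := (H ^ 2 + H * |x|) / (1 + H ^ 2 + H * |x|) with hr
  have hr0 : 0 ≤ r := by positivity
  rw [iteratedDeriv_two_phi, iteratedDeriv_two_phi, ← mul_sub, ← integral_sub (hcos _) (hcos _),
    abs_mul, abs_of_pos (by positivity : 0 < 1 / (2 * π)), mul_div_assoc, ← hr, add_mul, one_mul,
    mul_assoc, ← integral_mul_const]
  refine le_add_of_le_of_nonneg ?_ hr0
  gcongr
  rw [← norm_eq_abs]
  refine norm_integral_le_of_norm_le (hint.mul_const r) (ae_of_all _ fun ω => ?_)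
  rw [← mul_sub, norm_mul, norm_of_nonneg (by positivity), mul_assoc _ _ r]
  gcongr
  exact abs_cos_mul_sub_cos_mul_le ω x hH
end

section
/- There exists a constant C > 0 such that for every measurable function a : ℝ → ℝ with |a(y)| ≤ 1 for all y, every x ∈ ℝ, every t ≥ 0 and every h > 0, ∫₀^h ds ∫_ℝ dy (1/s) φ'((x−y)/s^{1/4})² a(y)² + ∫₀^t ds ∫_ℝ dy [ (s+h)^{−1/2} φ'((x−y)/(s+h)^{1/4}) − s^{−1/2} φ'((x−y)/s^{1/4}) ]² a(y)² ≤ C h^{1/4}. (This sum equals the second moment E(Y(x,t+h) − Y(x,t))² of the temporal increment of the stochastic convolution Y associated with G and white noise.) -/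
open MeasureTheory Real

open scoped ContDiff SchwartzMap FourierTransform

lemma exists_bound_polynomial_mul_exp_neg_pow_four (Q : Polynomial ℝ) :
    ∃ C : ℝ, ∀ x : ℝ, |Q.eval x| * exp (-(x ^ 4) / 2) ≤ C := by
  induction Q using Polynomial.induction_on' with
  | add p q hp hq =>
    obtain ⟨C, hC⟩ := hp
    obtain ⟨D, hD⟩ := hq
    refine ⟨C + D, fun x => ?_⟩
    have := abs_add_le (p.eval x) (q.eval x)
    rw [Polynomial.eval_add]
    calc _ ≤ (|p.eval x| + |q.eval x|) * exp (-(x ^ 4) / 2) := by gcongr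
      _ ≤ _ := by linarith [hC x, hD x]
  | monomial n a =>
    refine ⟨|a| * (1 + 2 ^ n * n.factorial), fun x => ?_⟩
    have h1 : |x| ^ n ≤ 1 + (x ^ 4) ^ n := by
      rcases le_total |x| 1 with h | h
      · have := pow_le_one₀ (n := n) (abs_nonneg x) h
        have : 0 ≤ (x ^ 4) ^ n := by positivity
        linarith
      · have h4 : |x| ≤ x ^ 4 := by
          rw [← Even.pow_abs (by decide : Even 4)]
          exact le_self_pow₀ h (by norm_num)
        have := pow_le_pow_left₀ (abs_nonneg x) h4 n
        linarith
    have h2 : (x ^ 4) ^ n ≤ 2 ^ n * n.factorial * exp (x ^ 4 / 2) := by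
      have := pow_div_factorial_le_exp (x ^ 4 / 2) (by positivity) n
      rw [div_le_iff₀ (by positivity), div_pow, div_le_iff₀ (by positivity)] at this
      linarith
    have h3 : exp (-(x ^ 4) / 2) ≤ 1 := exp_le_one_iff.2 (by
      have : 0 ≤ x ^ 4 := by positivity
      linarith)
    have h4 : exp (x ^ 4 / 2) * exp (-(x ^ 4) / 2) = 1 := by
      rw [← exp_add]; ring_nf; exact exp_zero
    rw [Polynomial.eval_monomial, abs_mul, abs_pow, mul_assoc]
    gcongr
    calc |x| ^ n * exp (-(x ^ 4) / 2)
        ≤ (1 + 2 ^ n * n.factorial * exp (x ^ 4 / 2)) * exp (-(x ^ 4) / 2) := by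
          gcongr; linarith
      _ = exp (-(x ^ 4) / 2) + 2 ^ n * n.factorial * (exp (x ^ 4 / 2) * exp (-(x ^ 4) / 2)) := by
          ring
      _ ≤ _ := by rw [h4]; linarith

lemma exists_iteratedDeriv_exp_neg_pow_four (n : ℕ) :
    ∃ P : Polynomial ℝ, iteratedDeriv n (fun x : ℝ => ((exp (-(x ^ 4) / 2) : ℝ) : ℂ)) =
      fun x : ℝ => ((P.eval x * exp (-(x ^ 4) / 2) : ℝ) : ℂ) := by
  induction n with
  | zero => exact ⟨1, by simp⟩
  | succ n ih =>
    obtain ⟨P, hP⟩ := ih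
    refine ⟨Polynomial.derivative P - 2 * Polynomial.X ^ 3 * P, ?_⟩
    rw [iteratedDeriv_succ, hP]
    funext x
    have h1 : HasDerivAt (fun x : ℝ => -(x ^ 4) / 2) (-(2 * x ^ 3)) x := by
      have := ((hasDerivAt_pow 4 x).neg.div_const 2)
      convert! this using 1
      norm_num
      ring
    have h2 := ((P.hasDerivAt x).mul h1.exp).ofReal_comp
    refine (h2.congr_deriv ?_).deriv
    simp
    ring

/-- The Schwartz function `ω ↦ exp (-ω⁴/2)`. -/
noncomputable def expNegPowFour : 𝓢(ℝ, ℂ) where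
  toFun x := ((exp (-(x ^ 4) / 2) : ℝ) : ℂ)
  smooth' := Complex.ofRealCLM.contDiff.comp
    (by fun_prop : ContDiff ℝ ∞ fun x : ℝ => exp (-(x ^ 4) / 2))
  decay' k n := by
    obtain ⟨P, hP⟩ := exists_iteratedDeriv_exp_neg_pow_four n
    obtain ⟨C, hC⟩ := exists_bound_polynomial_mul_exp_neg_pow_four (Polynomial.X ^ k * P)
    refine ⟨C, fun x => le_of_eq_of_le ?_ (hC x)⟩
    rw [norm_iteratedFDeriv_eq_norm_iteratedDeriv, hP]
    simp [abs_mul, Complex.norm_real, abs_of_pos (exp_pos _), mul_assoc, -Complex.ofReal_exp]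

lemma phi_eq_re_fourier (x : ℝ) :
    phi x = 1 / (2 * π) * ((𝓕 expNegPowFour) (x / (2 * π))).re := by
  rw [phi, SchwartzMap.fourier_coe, fourier_real_eq_integral_exp_smul]
  congr 1
  have hint : Integrable (fun v : ℝ =>
      Complex.exp (↑(-2 * π * v * (x / (2 * π))) * Complex.I) • expNegPowFour v) := by
    refine expNegPowFour.integrable.norm.mono' ?_ (.of_forall fun v => ?_)
    · exact Continuous.aestronglyMeasurable
        ((by fun_prop : Continuous fun v : ℝ => Complex.exp
          (↑(-2 * π * v * (x / (2 * π))) * Complex.I)).smul expNegPowFour.continuous)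
    · rw [norm_smul, Complex.norm_exp_ofReal_mul_I, one_mul]
  have hre := Complex.reCLM.integral_comp_comm hint
  simp only [Complex.reCLM_apply] at hre
  rw [← hre]
  congr 1
  funext v
  have hv : -2 * π * v * (x / (2 * π)) = -(v * x) := by field_simp
  rw [hv]
  change _ = (Complex.exp (↑(-(v * x)) * Complex.I) * ((exp (-(v ^ 4) / 2) : ℝ) : ℂ)).re
  rw [Complex.re_mul_ofReal, Complex.exp_ofReal_mul_I_re, cos_neg, mul_comm]

/-- The real part of a rescaled Schwartz function is differentiable with the expected derivative. -/
lemma hasDerivAt_re_schwartz (g : 𝓢(ℝ, ℂ)) (a c x : ℝ) :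
    HasDerivAt (fun x => a * (g (x / c)).re)
      (a / c * ((SchwartzMap.derivCLM ℝ ℂ g) (x / c)).re) x := by
  have h1 := (g.hasDerivAt (x / c)).scomp x ((hasDerivAt_id x).div_const c)
  have h2 := (Complex.reCLM.hasFDerivAt.comp_hasDerivAt x h1).const_mul a
  refine h2.congr_deriv ?_
  simp
  ring

/-- Quadratic decay of Schwartz functions multiplied by a power. -/
lemma exists_decay_schwartz (g : 𝓢(ℝ, ℂ)) (k : ℕ) :
    ∃ C : ℝ, 0 < C ∧ ∀ x : ℝ, |x| ^ k * ‖g x‖ * (1 + x ^ 2) ≤ C := by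
  obtain ⟨C, hC, h⟩ := g.decay k 0
  obtain ⟨D, hD, h'⟩ := g.decay (k + 2) 0
  refine ⟨C + D, by positivity, fun x => ?_⟩
  have h1 := h x
  have h2 := h' x
  simp only [norm_iteratedFDeriv_zero, norm_eq_abs, pow_add, sq_abs] at h1 h2
  linarith

/-- `φ'` is differentiable, and `φ'(u)` and `u φ''(u)` decay at least quadratically. -/
lemma exists_deriv_phi_bounds :
    ∃ A > (0 : ℝ), ∃ ψ : ℝ → ℝ, (∀ x, HasDerivAt (deriv phi) (ψ x) x) ∧
      (∀ x, |deriv phi x| ≤ A * (1 + x ^ 2)⁻¹) ∧ (∀ x, |x * ψ x| ≤ A * (1 + x ^ 2)⁻¹) := by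
  set g := 𝓕 expNegPowFour
  set g1 := SchwartzMap.derivCLM ℝ ℂ g
  set g2 := SchwartzMap.derivCLM ℝ ℂ g1
  set c := 2 * π with hc_def
  have hc : 1 ≤ c := by have := pi_gt_three; linarith
  have hc0 : 0 < c := by positivity
  have hphi : phi = fun x => 1 / c * (g (x / c)).re := funext phi_eq_re_fourier
  have hd : deriv phi = fun x => 1 / c / c * (g1 (x / c)).re := by
    funext x
    rw [hphi]
    exact (hasDerivAt_re_schwartz g _ c x).deriv
  obtain ⟨A, hA, hA'⟩ := exists_decay_schwartz g1 0
  obtain ⟨B, hB, hB'⟩ := exists_decay_schwartz g2 1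
  have key : ∀ x : ℝ, 1 + x ^ 2 ≤ c ^ 2 * (1 + (x / c) ^ 2) := fun x => by
    have : c ^ 2 * (1 + (x / c) ^ 2) = c ^ 2 + x ^ 2 := by field_simp
    nlinarith
  refine ⟨A + B, by positivity, fun x => 1 / c / c / c * (g2 (x / c)).re,
    fun x => hd ▸ hasDerivAt_re_schwartz g1 _ c x, fun x => ?_, fun x => ?_⟩
  · rw [← div_eq_mul_inv, le_div_iff₀ (by positivity), hd]
    have h1 := hA' (x / c)
    simp only [abs_mul, abs_of_pos (show 0 < 1 / c / c by positivity)]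
    calc 1 / c / c * |(g1 (x / c)).re| * (1 + x ^ 2)
        ≤ 1 / c / c * ‖g1 (x / c)‖ * (c ^ 2 * (1 + (x / c) ^ 2)) := by
          gcongr
          · exact Complex.abs_re_le_norm _
          · exact key x
      _ = |x / c| ^ 0 * ‖g1 (x / c)‖ * (1 + (x / c) ^ 2) := by
          field_simp
      _ ≤ _ := by linarith
  · rw [← div_eq_mul_inv, le_div_iff₀ (by positivity)]
    have h1 := hB' (x / c)
    simp only [abs_mul, abs_of_pos (show 0 < 1 / c / c / c by positivity)]
    calc |x| * (1 / c / c / c * |(g2 (x / c)).re|) * (1 + x ^ 2)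
        ≤ |x| * (1 / c / c / c * ‖g2 (x / c)‖) * (c ^ 2 * (1 + (x / c) ^ 2)) := by
          gcongr
          · exact Complex.abs_re_le_norm _
          · exact key x
      _ = |x / c| ^ 1 * ‖g2 (x / c)‖ * (1 + (x / c) ^ 2) := by
          rw [abs_div, abs_of_pos hc0]
          field_simp
      _ ≤ _ := by linarith

lemma integral_le_of_le_cauchy_profiles {F : ℝ → ℝ} {M N c d x : ℝ} (hc : 0 < c) (hd : 0 < d)
    (h0 : ∀ y, 0 ≤ F y)
    (hF : ∀ y, F y ≤ M * (1 + ((x - y) / c) ^ 2)⁻¹ + N * (1 + ((x - y) / d) ^ 2)⁻¹) :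
    ∫ y, F y ≤ (M * c + N * d) * π := by
  have hint : ∀ {b : ℝ}, 0 < b → Integrable fun y : ℝ => (1 + ((x - y) / b) ^ 2)⁻¹ := fun hb =>
    (integrable_inv_one_add_sq.comp_div hb.ne').comp_sub_left x
  have hval : ∀ {b : ℝ}, 0 < b → ∫ y : ℝ, (1 + ((x - y) / b) ^ 2)⁻¹ = b * π := fun {b} hb => by
    rw [integral_sub_left_eq_self (fun z : ℝ => (1 + (z / b) ^ 2)⁻¹) volume x,
      Measure.integral_comp_div (fun z : ℝ => (1 + z ^ 2)⁻¹) b, integral_univ_inv_one_add_sq,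
      abs_of_pos hb, smul_eq_mul]
  calc ∫ y, F y
      ≤ ∫ y, (M * (1 + ((x - y) / c) ^ 2)⁻¹ + N * (1 + ((x - y) / d) ^ 2)⁻¹) :=
        integral_mono_of_nonneg (.of_forall h0)
          (((hint hc).const_mul M).add ((hint hd).const_mul N)) (.of_forall hF)
    _ = (M * c + N * d) * π := by
        rw [integral_add ((hint hc).const_mul M) ((hint hd).const_mul N), integral_const_mul,
          integral_const_mul, hval hc, hval hd]
        ring

lemma intervalIntegral_le_of_le_two_powers {I : ℝ → ℝ} {M t h : ℝ} (hM : 0 ≤ M) (ht : 0 ≤ t)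
    (hh : 0 < h) (h0 : ∀ s, 0 < s → 0 ≤ I s)
    (hsmall : ∀ s, 0 < s → s ≤ h → I s ≤ M * s ^ (-(3 / 4) : ℝ))
    (hlarge : ∀ s, h < s → s ≤ t → I s ≤ M * (h ^ 2 * s ^ (-(11 / 4) : ℝ))) :
    ∫ s in (0 : ℝ)..t, I s ≤ M * (32 / 7) * h ^ ((1 : ℝ) / 4) := by
  set G1 : ℝ → ℝ := (Set.Ioc 0 h).indicator fun s => M * s ^ (-(3 / 4) : ℝ)
  set G2 : ℝ → ℝ := (Set.Ioi h).indicator fun s => M * (h ^ 2 * s ^ (-(11 / 4) : ℝ))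
  have hG1 : Integrable G1 := by
    refine (integrable_indicator_iff measurableSet_Ioc).2 (Integrable.const_mul ?_ M)
    exact (intervalIntegrable_iff_integrableOn_Ioc_of_le hh.le).1
      (intervalIntegral.intervalIntegrable_rpow' (by norm_num))
  have hG2 : Integrable G2 := by
    refine (integrable_indicator_iff measurableSet_Ioi).2 (Integrable.const_mul ?_ M)
    exact (integrableOn_Ioi_rpow_of_lt (by norm_num) hh).const_mul _
  have hG1i : ∫ s, G1 s = M * (4 * h ^ ((1 : ℝ) / 4)) := by
    rw [integral_indicator measurableSet_Ioc, integral_const_mul,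
      ← intervalIntegral.integral_of_le hh.le, integral_rpow (Or.inl (by norm_num)),
      zero_rpow (by norm_num)]
    norm_num
    left
    ring
  have hG2i : ∫ s, G2 s = M * (4 / 7 * h ^ ((1 : ℝ) / 4)) := by
    rw [integral_indicator measurableSet_Ioi, integral_const_mul, integral_const_mul,
      integral_Ioi_rpow_of_lt (by norm_num) hh]
    have : h ^ ((1 : ℝ) / 4) = h ^ 2 * h ^ (-(11 / 4) + 1 : ℝ) := by
      rw [← rpow_natCast h 2, ← rpow_add hh]
      norm_num
    rw [this]
    ring
  have hG1n : ∀ s, 0 ≤ G1 s := Set.indicator_nonneg fun s hs => by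
    have := hs.1
    positivity
  have hG2n : ∀ s, 0 ≤ G2 s := Set.indicator_nonneg fun s hs => by
    have : 0 < s := hh.trans hs
    positivity
  rw [intervalIntegral.integral_of_le ht]
  calc ∫ s in Set.Ioc 0 t, I s ≤ ∫ s in Set.Ioc 0 t, (G1 s + G2 s) := by
        refine integral_mono_of_nonneg ?_ (hG1.add hG2).integrableOn ?_
        · filter_upwards [ae_restrict_mem measurableSet_Ioc] with s hs using h0 s hs.1
        · filter_upwards [ae_restrict_mem measurableSet_Ioc] with s hs
          rcases le_or_gt s h with hsh | hsh
          · have h1 : G1 s = _ := Set.indicator_of_mem (show s ∈ Set.Ioc 0 h from ⟨hs.1, hsh⟩) _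
            linarith [hsmall s hs.1 hsh, hG2n s]
          · have h2 : G2 s = _ := Set.indicator_of_mem (show s ∈ Set.Ioi h from hsh) _
            linarith [hlarge s hsh hs.2, hG1n s]
    _ ≤ ∫ s, (G1 s + G2 s) := setIntegral_le_integral (hG1.add hG2)
        (.of_forall fun s => add_nonneg (hG1n s) (hG2n s))
    _ = M * (32 / 7) * h ^ ((1 : ℝ) / 4) := by
        rw [integral_add hG1 hG2, hG1i, hG2i]
        ring

/-- Time derivative of the self-similar kernel `r^{-1/2} f (z r^{-1/4})`. -/
lemma hasDerivAt_selfSimilar {f ψ : ℝ → ℝ} (hf : ∀ x, HasDerivAt f (ψ x) x) {r : ℝ} (hr : 0 < r)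
    (z : ℝ) :
    HasDerivAt (fun r : ℝ => r ^ (-(1 / 2) : ℝ) * f (z / r ^ ((1 : ℝ) / 4)))
      (-(r ^ (-(3 / 2) : ℝ)) * (f (z / r ^ ((1 : ℝ) / 4)) / 2 +
        z / r ^ ((1 : ℝ) / 4) * ψ (z / r ^ ((1 : ℝ) / 4)) / 4)) r := by
  have h1 := hasDerivAt_rpow_const (p := (-(1 / 2) : ℝ)) (Or.inl hr.ne')
  have h2 := hasDerivAt_rpow_const (p := (1 : ℝ) / 4) (Or.inl hr.ne')
  have hq : 0 < r ^ ((1 : ℝ) / 4) := by positivity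
  have h3 := (hasDerivAt_const r z).div h2 hq.ne'
  have h4 := (hf (z / r ^ ((1 : ℝ) / 4))).comp r h3
  refine (h1.mul h4).congr_deriv ?_
  have e1 : r ^ ((1 : ℝ) / 4 - 1) = r ^ ((1 : ℝ) / 4) * r⁻¹ := by
    rw [rpow_sub_one hr.ne', div_eq_mul_inv]
  have e2 : r ^ (-(3 / 2) : ℝ) = r ^ (-(1 / 2) : ℝ) * r⁻¹ := by
    rw [← div_eq_mul_inv, ← rpow_sub_one hr.ne']
    norm_num
  have e3 : r ^ (-(1 / 2) - 1 : ℝ) = r ^ (-(1 / 2) : ℝ) * r⁻¹ := by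
    rw [rpow_sub_one hr.ne', div_eq_mul_inv]
  rw [e1, e2, e3]
  simp only [Function.comp_apply, Pi.div_apply]
  field_simp
  ring

lemma abs_selfSimilar_sub_le {f ψ : ℝ → ℝ} {A : ℝ} (hA : 0 < A)
    (hf : ∀ x, HasDerivAt f (ψ x) x) (hf' : ∀ x, |f x| ≤ A * (1 + x ^ 2)⁻¹)
    (hψ : ∀ x, |x * ψ x| ≤ A * (1 + x ^ 2)⁻¹) {s h : ℝ} (hh : 0 < h) (hs : h ≤ s) (z : ℝ) :
    |(s + h) ^ (-(1 / 2) : ℝ) * f (z / (s + h) ^ ((1 : ℝ) / 4)) -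
      s ^ (-(1 / 2) : ℝ) * f (z / s ^ ((1 : ℝ) / 4))| ≤
      2 * A * s ^ (-(3 / 2) : ℝ) * h * (1 + (z / s ^ ((1 : ℝ) / 4)) ^ 2)⁻¹ := by
  have hs0 : 0 < s := hh.trans_le hs
  have hmem : ∀ r ∈ Set.Icc s (s + h), 0 < r := fun r hr => hs0.trans_le hr.1
  have key := (convex_Icc s (s + h)).norm_image_sub_le_of_norm_hasDerivWithin_le
    (C := 2 * A * s ^ (-(3 / 2) : ℝ) * (1 + (z / s ^ ((1 : ℝ) / 4)) ^ 2)⁻¹)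
    (fun r hr => (hasDerivAt_selfSimilar hf (hmem r hr) z).hasDerivWithinAt) ?_
    (Set.left_mem_Icc.2 (by linarith)) (Set.right_mem_Icc.2 (by linarith))
  · rw [norm_eq_abs, norm_eq_abs, add_sub_cancel_left, abs_of_pos hh] at key
    exact key.trans_eq (by ring)
  intro r hr
  have hr0 := hmem r hr
  set p := s ^ ((1 : ℝ) / 4) with hp_def
  set q := r ^ ((1 : ℝ) / 4) with hq_def
  have hp : 0 < p := by positivity
  have hq : 0 < q := by positivity
  have hp4 : p ^ 4 = s := by
    rw [hp_def, ← rpow_natCast, ← rpow_mul hs0.le]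
    norm_num
  have hq4 : q ^ 4 = r := by
    rw [hq_def, ← rpow_natCast, ← rpow_mul hr0.le]
    norm_num
  have hqp : q ^ 2 ≤ 2 * p ^ 2 := by
    refine le_of_sq_le_sq ?_ (by positivity)
    have : r ≤ 2 * s := by linarith [hr.2]
    nlinarith [pow_pos hp 4]
  have hinv : (1 + (z / q) ^ 2)⁻¹ ≤ 2 * (1 + (z / p) ^ 2)⁻¹ := by
    rw [inv_eq_one_div, ← div_eq_mul_inv, div_le_div_iff₀ (by positivity) (by positivity)]
    have : (z / p) ^ 2 ≤ 2 * (z / q) ^ 2 := by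
      rw [div_pow, div_pow, ← mul_div_assoc, div_le_div_iff₀ (by positivity) (by positivity)]
      nlinarith [mul_le_mul_of_nonneg_left hqp (sq_nonneg z)]
    linarith
  have hpow : r ^ (-(3 / 2) : ℝ) ≤ s ^ (-(3 / 2) : ℝ) :=
    rpow_le_rpow_of_nonpos hs0 hr.1 (by norm_num)
  have hsum : |f (z / q) / 2 + z / q * ψ (z / q) / 4| ≤ A * (1 + (z / q) ^ 2)⁻¹ := by
    refine (abs_add_le _ _).trans ?_
    rw [abs_div, abs_div, abs_of_pos (show (0 : ℝ) < 2 by norm_num),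
      abs_of_pos (show (0 : ℝ) < 4 by norm_num)]
    have h1 := hf' (z / q)
    have h2 := hψ (z / q)
    have h3 : 0 ≤ A * (1 + (z / q) ^ 2)⁻¹ := by positivity
    linarith
  rw [norm_eq_abs, abs_mul, abs_neg, abs_of_pos (by positivity : 0 < r ^ (-(3 / 2) : ℝ))]
  calc _ ≤ s ^ (-(3 / 2) : ℝ) * (A * (2 * (1 + (z / p) ^ 2)⁻¹)) := by
        gcongr
        exact hsum.trans (by gcongr)
    _ = _ := by ring

lemma mul_sq_le_of_abs_le {v a c w : ℝ} (ha : |a| ≤ 1) (hw0 : 0 ≤ w) (hw1 : w ≤ 1)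
    (hv : |v| ≤ c * w) : v ^ 2 * a ^ 2 ≤ c ^ 2 * w := by
  have h1 : v ^ 2 ≤ (c * w) ^ 2 := sq_le_sq' (neg_le_of_abs_le hv) (le_of_abs_le hv)
  have h2 : a ^ 2 ≤ 1 := (sq_le_one_iff_abs_le_one a).2 ha
  calc v ^ 2 * a ^ 2 ≤ v ^ 2 := mul_le_of_le_one_right (sq_nonneg v) h2
    _ ≤ c ^ 2 * (w * w) := h1.trans_eq (by ring)
    _ ≤ c ^ 2 * w := by gcongr; exact mul_le_of_le_one_left hw0 hw1

lemma inv_one_add_sq_le_one (u : ℝ) : (1 + u ^ 2)⁻¹ ≤ 1 :=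
  inv_le_one_of_one_le₀ (by linarith [sq_nonneg u])

/-- There is `C > 0` such that for every measurable `a : ℝ → ℝ` with `|a| ≤ 1`, every
`x ∈ ℝ`, `t ≥ 0` and `h > 0`,
`∫₀^h ds ∫ dy (1/s) φ'((x−y)/s^{1/4})² a(y)²
 + ∫₀^t ds ∫ dy [(s+h)^{−1/2} φ'((x−y)/(s+h)^{1/4}) − s^{−1/2} φ'((x−y)/s^{1/4})]² a(y)²
 ≤ C h^{1/4}`
(the second moment `E(Y(x,t+h) − Y(x,t))²` of the temporal increment of `Y`). -/
theorem temporal_increment_bound_Y :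
    ∃ C > (0 : ℝ), ∀ a : ℝ → ℝ, Measurable a → (∀ y, |a y| ≤ 1) →
      ∀ x t h : ℝ, 0 ≤ t → 0 < h →
        (∫ s in (0 : ℝ)..h, ∫ y : ℝ,
            (1 / s) * (deriv phi ((x - y) / s ^ ((1 : ℝ) / 4))) ^ 2 * a y ^ 2)
        + (∫ s in (0 : ℝ)..t, ∫ y : ℝ,
            ((s + h) ^ (-(1 / 2) : ℝ) * deriv phi ((x - y) / (s + h) ^ ((1 : ℝ) / 4))
              - s ^ (-(1 / 2) : ℝ) * deriv phi ((x - y) / s ^ ((1 : ℝ) / 4))) ^ 2 * a y ^ 2)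
          ≤ C * h ^ ((1 : ℝ) / 4) := by
  obtain ⟨A, hA, ψ, hd, hφ, hψ⟩ := exists_deriv_phi_bounds
  refine ⟨2 * (4 * A ^ 2 * π * (32 / 7)), by positivity, fun a _ ha x t h ht hh => ?_⟩
  have hM : 0 ≤ 4 * A ^ 2 * π := by positivity
  have hw0 : ∀ u : ℝ, 0 ≤ (1 + u ^ 2)⁻¹ := fun u => by positivity
  have hkernel : ∀ {s : ℝ}, 0 < s → ∀ y,
      (s ^ (-(1 / 2) : ℝ) * deriv phi ((x - y) / s ^ ((1 : ℝ) / 4))) ^ 2 * a y ^ 2 ≤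
        (s ^ (-(1 / 2) : ℝ) * A) ^ 2 * (1 + ((x - y) / s ^ ((1 : ℝ) / 4)) ^ 2)⁻¹ :=
    fun {s} hs y => mul_sq_le_of_abs_le (ha y) (hw0 _) (inv_one_add_sq_le_one _) (by
      rw [abs_mul, abs_of_pos (by positivity : 0 < s ^ (-(1 / 2) : ℝ)), mul_assoc]
      gcongr
      exact hφ _)
  have hsq : ∀ {s : ℝ}, 0 < s → (s ^ (-(1 / 2) : ℝ)) ^ 2 = 1 / s := fun {s} hs => by
    rw [← rpow_natCast, ← rpow_mul hs.le, show (-(1 / 2) : ℝ) * ((2 : ℕ) : ℝ) = -1 by norm_num,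
      rpow_neg_one, one_div]
  have hscale : ∀ {s : ℝ}, 0 < s →
      (s ^ (-(1 / 2) : ℝ) * A) ^ 2 * s ^ ((1 : ℝ) / 4) = A ^ 2 * s ^ (-(3 / 4) : ℝ) :=
    fun {s} hs => by
      rw [mul_pow, ← rpow_natCast (s ^ _), ← rpow_mul hs.le, mul_right_comm, ← rpow_add hs,
        mul_comm]
      norm_num
  have hfirst : ∫ s in (0 : ℝ)..h, ∫ y : ℝ,
      (1 / s) * (deriv phi ((x - y) / s ^ ((1 : ℝ) / 4))) ^ 2 * a y ^ 2 ≤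
      4 * A ^ 2 * π * (32 / 7) * h ^ ((1 : ℝ) / 4) := by
    refine intervalIntegral_le_of_le_two_powers hM hh.le hh
      (fun s hs => integral_nonneg fun y => by positivity) (fun s hs _ => ?_)
      (fun s hs hs' => absurd hs (not_lt.2 hs'))
    have hs4 : 0 < s ^ ((1 : ℝ) / 4) := by positivity
    refine (integral_le_of_le_cauchy_profiles (N := 0) (x := x) hs4 hs4
      (fun y => by positivity) fun y => ?_).trans
      (?_ : ((s ^ (-(1 / 2) : ℝ) * A) ^ 2 * s ^ ((1 : ℝ) / 4) + 0 * _) * π ≤ _)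
    · rw [zero_mul, add_zero, ← hsq hs, ← mul_pow]
      exact hkernel hs y
    · rw [hscale hs]
      have : 0 ≤ A ^ 2 * π * s ^ (-(3 / 4) : ℝ) := by positivity
      linarith
  have hsecond : ∫ s in (0 : ℝ)..t, ∫ y : ℝ,
      ((s + h) ^ (-(1 / 2) : ℝ) * deriv phi ((x - y) / (s + h) ^ ((1 : ℝ) / 4))
        - s ^ (-(1 / 2) : ℝ) * deriv phi ((x - y) / s ^ ((1 : ℝ) / 4))) ^ 2 * a y ^ 2 ≤
      4 * A ^ 2 * π * (32 / 7) * h ^ ((1 : ℝ) / 4) := by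
    refine intervalIntegral_le_of_le_two_powers hM ht hh
      (fun s hs => integral_nonneg fun y => by positivity) (fun s hs _ => ?_)
      (fun s hs _ => ?_)
    · have hsh : 0 < s + h := by positivity
      refine (integral_le_of_le_cauchy_profiles (x := x)
        (M := 2 * ((s + h) ^ (-(1 / 2) : ℝ) * A) ^ 2) (N := 2 * (s ^ (-(1 / 2) : ℝ) * A) ^ 2)
        (c := (s + h) ^ ((1 : ℝ) / 4)) (d := s ^ ((1 : ℝ) / 4)) (by positivity) (by positivity)
        (fun y => by positivity) fun y => ?_).trans ?_
      · have h1 := hkernel hsh y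
        have h2 := hkernel hs y
        generalize (s + h) ^ (-(1 / 2) : ℝ) * deriv phi ((x - y) / (s + h) ^ ((1 : ℝ) / 4)) = u
          at h1 ⊢
        generalize s ^ (-(1 / 2) : ℝ) * deriv phi ((x - y) / s ^ ((1 : ℝ) / 4)) = v at h2 ⊢
        have : (u - v) ^ 2 * a y ^ 2 ≤ 2 * (u ^ 2 * a y ^ 2) + 2 * (v ^ 2 * a y ^ 2) := by
          nlinarith [mul_nonneg (sq_nonneg (u + v)) (sq_nonneg (a y))]
        linarith
      · rw [mul_assoc, hscale hsh, mul_assoc, hscale hs]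
        have : (s + h) ^ (-(3 / 4) : ℝ) ≤ s ^ (-(3 / 4) : ℝ) :=
          rpow_le_rpow_of_nonpos hs (by linarith) (by norm_num)
        calc _ ≤ (2 * (A ^ 2 * s ^ (-(3 / 4) : ℝ)) + 2 * (A ^ 2 * s ^ (-(3 / 4) : ℝ))) * π := by
              gcongr
          _ = _ := by ring
    · have hs0 : 0 < s := hh.trans hs
      have hs4 : 0 < s ^ ((1 : ℝ) / 4) := by positivity
      refine (integral_le_of_le_cauchy_profiles (N := 0) (x := x) hs4 hs4
        (fun y => by positivity) fun y => ?_).trans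
        (?_ : ((2 * A * s ^ (-(3 / 2) : ℝ) * h) ^ 2 * s ^ ((1 : ℝ) / 4) + 0 * _) * π ≤ _)
      · rw [zero_mul, add_zero]
        exact mul_sq_le_of_abs_le (ha y) (hw0 _) (inv_one_add_sq_le_one _)
          (abs_selfSimilar_sub_le hA hd hφ hψ hh hs.le (x - y))
      · have e : s ^ (-(11 / 4) : ℝ) = (s ^ (-(3 / 2) : ℝ)) ^ 2 * s ^ ((1 : ℝ) / 4) := by
          rw [← rpow_natCast (s ^ _), ← rpow_mul hs0.le, ← rpow_add hs0]
          norm_num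
        rw [e]
        exact le_of_eq (by ring)
  linarith
end

section
/- Let u₀ : ℝ → ℝ be continuous and bounded, and let q : ℝ × [0,∞) → ℝ be continuous and bounded. Then there exists T₀ > 0 (depending only on the sup norms of u₀ and q) such that the integral equation u(x,t) = ∫_ℝ G(x,y,t) u₀(y) dy + ∫₀^t ∫_ℝ ∂_y² G(x,y,t−s) V'(u(y,s)) dy ds + q(x,t) has a unique continuous bounded solution u on ℝ × [0,T₀]. -/
open MeasureTheory Real

/-- `G(x,y,t) = t^{−1/4} φ((x−y) t^{−1/4})`, the Green function of `e^{−(t/2)Δ²}` on `ℝ`. -/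
noncomputable def G (x y t : ℝ) : ℝ :=
  t ^ (-(1 / 4) : ℝ) * phi ((x - y) * t ^ (-(1 / 4) : ℝ))

/-- `∂_y² G(x,y,t) = t^{−3/4} φ''((x−y) t^{−1/4})`. -/
noncomputable def Gyy (x y t : ℝ) : ℝ :=
  t ^ (-(3 / 4) : ℝ) * iteratedDeriv 2 phi ((x - y) * t ^ (-(1 / 4) : ℝ))

/-- `V'(u) = u³ − u` for the double-well potential `V(u) = (1/4)(u²−1)²`. -/
def Vp (u : ℝ) : ℝ := u ^ 3 - u

/-- `u` is a continuous bounded mild solution on `ℝ × [0,T]` of the Cahn–Hilliard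
integral equation `u(x,t) = ∫ G(x,y,t) u₀(y) dy + ∫₀^t ∫ ∂_y²G(x,y,t−s) V'(u(y,s)) dy ds
+ q(x,t)`. -/
def IsMildSolution (T : ℝ) (u₀ : ℝ → ℝ) (q : ℝ → ℝ → ℝ) (u : ℝ → ℝ → ℝ) : Prop :=
  ContinuousOn (fun p : ℝ × ℝ => u p.1 p.2) (Set.univ ×ˢ Set.Icc 0 T) ∧
  (∃ K : ℝ, ∀ x : ℝ, ∀ t ∈ Set.Icc (0 : ℝ) T, |u x t| ≤ K) ∧
  (∀ x : ℝ, ∀ t ∈ Set.Ioc (0 : ℝ) T,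
    u x t = (∫ y : ℝ, G x y t * u₀ y)
      + (∫ s in (0 : ℝ)..t, ∫ y : ℝ, Gyy x y (t - s) * Vp (u y s))
      + q x t)

open scoped SchwartzMap FourierTransform

theorem exists_bound_eval_mul_exp_neg_quartic (P : Polynomial ℝ) :
    ∃ C : ℝ, ∀ x : ℝ, |P.eval x * rexp (-((2 * π * x) ^ 4) / 2)| ≤ C := by
  induction P using Polynomial.induction_on' with
  | add p q hp hq =>
    obtain ⟨C, hC⟩ := hp
    obtain ⟨D, hD⟩ := hq
    refine ⟨C + D, fun x => ?_⟩
    rw [Polynomial.eval_add, add_mul]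
    exact (abs_add_le _ _).trans (add_le_add (hC x) (hD x))
  | monomial n a =>
    refine ⟨|a| * (1 + n.factorial), fun x => ?_⟩
    set u : ℝ := (2 * π * x) ^ 4 / 2 with hu
    have hx0 : 0 ≤ x ^ 4 := by positivity
    have hxu : x ^ 4 ≤ u := by
      have h1 : (1 : ℝ) ≤ 2 * π := by linarith [pi_gt_three]
      have h2 : (6 : ℝ) ^ 4 ≤ (2 * π) ^ 4 := by
        gcongr
        linarith [pi_gt_three]
      rw [hu, mul_pow]
      nlinarith
    have hu0 : 0 ≤ u := hx0.trans hxu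
    have hpow : |x| ^ n ≤ 1 + u ^ n := by
      rcases le_total |x| 1 with h | h
      · have := pow_le_one₀ (n := n) (abs_nonneg x) h
        have := pow_nonneg hu0 n
        linarith
      · have h4 : |x| ≤ x ^ 4 := by
          have := le_self_pow₀ h (n := 4) (by norm_num)
          simpa [pow_abs, abs_of_nonneg hx0] using this
        have := pow_le_pow_left₀ (abs_nonneg x) (h4.trans hxu) n
        linarith
    have hfac : u ^ n ≤ n.factorial * rexp u := by
      have := Real.pow_div_factorial_le_exp u hu0 n
      rwa [div_le_iff₀' (by positivity)] at this
    have hexp : (1 + u ^ n) * rexp (-u) ≤ 1 + n.factorial := by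
      have h1 : rexp (-u) ≤ 1 := by simpa using hu0
      have h2 : u ^ n * rexp (-u) ≤ n.factorial := by
        calc u ^ n * rexp (-u) ≤ n.factorial * rexp u * rexp (-u) := by gcongr
          _ = n.factorial := by rw [mul_assoc, ← Real.exp_add]; simp
      linarith
    rw [Polynomial.eval_monomial, abs_mul, abs_mul, abs_pow, abs_of_pos (Real.exp_pos _),
      mul_assoc, neg_div, ← hu]
    gcongr
    exact (mul_le_mul_of_nonneg_right hpow (Real.exp_pos _).le).trans hexp

theorem iteratedDeriv_exp_neg_quartic (n : ℕ) :
    ∃ P : Polynomial ℝ, iteratedDeriv n (fun x : ℝ => rexp (-((2 * π * x) ^ 4) / 2)) =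
      fun x => P.eval x * rexp (-((2 * π * x) ^ 4) / 2) := by
  induction n with
  | zero => exact ⟨1, by simp⟩
  | succ n ih =>
    obtain ⟨P, hP⟩ := ih
    refine ⟨Polynomial.derivative P +
      P * (Polynomial.C (-(2 * (2 * π) ^ 4)) * Polynomial.X ^ 3), ?_⟩
    rw [iteratedDeriv_succ, hP]
    ext x
    have h1 : HasDerivAt (fun x : ℝ => -((2 * π * x) ^ 4) / 2)
        (-(4 * (2 * π * x) ^ 3 * (2 * π * 1)) / 2) x := by
      simpa using ((((hasDerivAt_id x).const_mul (2 * π)).pow 4).neg).div_const 2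
    have := (P.hasDerivAt x).mul h1.exp
    refine this.deriv.trans ?_
    simp only [Polynomial.eval_add, Polynomial.eval_mul, Polynomial.eval_C, Polynomial.eval_pow,
      Polynomial.eval_X]
    ring

/-- `ω ↦ exp(−(2πω)⁴/2)` as a Schwartz function. -/
noncomputable def quarticSchwartz : 𝓢(ℝ, ℝ) where
  toFun x := rexp (-((2 * π * x) ^ 4) / 2)
  smooth' := by fun_prop
  decay' k n := by
    obtain ⟨P, hP⟩ := iteratedDeriv_exp_neg_quartic n
    obtain ⟨C, hC⟩ := exists_bound_eval_mul_exp_neg_quartic (Polynomial.X ^ k * P)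
    refine ⟨C, fun x => le_trans (le_of_eq ?_) (hC x)⟩
    rw [norm_iteratedFDeriv_eq_norm_iteratedDeriv, hP]
    simp [abs_mul, mul_assoc]

theorem quarticSchwartz_apply (x : ℝ) :
    quarticSchwartz x = rexp (-((2 * π * x) ^ 4) / 2) := rfl

/-- The complexification of `quarticSchwartz`. -/
noncomputable def quarticSchwartzC : 𝓢(ℝ, ℂ) :=
  SchwartzMap.postcompCLM Complex.ofRealCLM quarticSchwartz

theorem quarticSchwartzC_apply (x : ℝ) :
    quarticSchwartzC x = ((rexp (-((2 * π * x) ^ 4) / 2) : ℝ) : ℂ) := rfl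

/-- The profile `phi` as a Schwartz function. -/
noncomputable def phiSchwartz : 𝓢(ℝ, ℝ) :=
  SchwartzMap.postcompCLM Complex.reCLM (𝓕 quarticSchwartzC)

theorem phiSchwartz_coe : ⇑phiSchwartz = phi := by
  ext x
  have h1 : phiSchwartz x = (𝓕 (⇑quarticSchwartzC) x).re := by
    rw [← SchwartzMap.fourier_coe]; rfl
  have hint : Integrable (fun v : ℝ =>
      Complex.exp (((-2 * π * v * x : ℝ) : ℂ) * Complex.I) • quarticSchwartzC v) := by
    refine quarticSchwartzC.integrable.norm.mono' (by fun_prop) (.of_forall fun v => ?_)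
    rw [norm_smul, Complex.norm_exp_ofReal_mul_I, one_mul]
  have h2 : phiSchwartz x =
      ∫ v : ℝ, (fun w : ℝ => rexp (-(w ^ 4) / 2) * Real.cos (w * x)) (2 * π * v) := by
    rw [h1, Real.fourier_real_eq_integral_exp_smul, ← RCLike.re_eq_complex_re, ← integral_re hint]
    congr 1
    ext v
    rw [quarticSchwartzC_apply, smul_eq_mul, RCLike.re_eq_complex_re, Complex.re_mul_ofReal,
      Complex.exp_ofReal_mul_I_re, mul_comm]
    congr 1
    rw [← Real.cos_neg]
    congr 1
    ring
  rw [h2, Measure.integral_comp_mul_left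
    (fun w : ℝ => rexp (-(w ^ 4) / 2) * Real.cos (w * x)), phi, smul_eq_mul, abs_of_pos (by positivity), one_div]

theorem integrable_phi : Integrable phi := phiSchwartz_coe ▸ phiSchwartz.integrable

theorem iteratedDeriv_two_phi_s8 :
    iteratedDeriv 2 phi =
      ⇑(SchwartzMap.derivCLM ℝ ℝ (SchwartzMap.derivCLM ℝ ℝ phiSchwartz)) := by
  have h (f : 𝓢(ℝ, ℝ)) : ⇑(SchwartzMap.derivCLM ℝ ℝ f) = deriv f := by
    ext x
    exact SchwartzMap.derivCLM_apply ℝ f x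
  rw [iteratedDeriv_succ, iteratedDeriv_one, h, h, phiSchwartz_coe]

theorem integrable_iteratedDeriv_two_phi : Integrable (iteratedDeriv 2 phi) :=
  iteratedDeriv_two_phi_s8 ▸ SchwartzMap.integrable _

/-- `∫ k(z) h(x − z r, s) dz`. -/
noncomputable def spaceAvg (k : ℝ → ℝ) (h : ℝ → ℝ → ℝ) (x r s : ℝ) : ℝ :=
  ∫ z : ℝ, k z * h (x - z * r) s

/-- The Duhamel term with kernel profile `k`, in the similarity variable `σ = (t − s)/t`. -/
noncomputable def duhamel (k : ℝ → ℝ) (h : ℝ → ℝ → ℝ) (x t : ℝ) : ℝ :=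
  √t * ∫ σ in (0 : ℝ)..1,
    σ ^ (-(1 / 2) : ℝ) * spaceAvg k h x ((t * σ) ^ (1 / 4 : ℝ)) (t - t * σ)

theorem integral_rescaled_kernel_mul (k f : ℝ → ℝ) (x : ℝ) {r : ℝ} (hr : 0 < r) :
    ∫ y : ℝ, r⁻¹ * k ((x - y) * r⁻¹) * f y = ∫ z : ℝ, k z * f (x - z * r) := by
  have h1 : ∫ y : ℝ, r⁻¹ * k ((x - y) * r⁻¹) * f y =
      ∫ y : ℝ, r⁻¹ * k (y * r⁻¹) * f (x - y) := by
    rw [← integral_sub_left_eq_self _ volume x]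
    simp
  have h2 := Measure.integral_comp_mul_right (fun y : ℝ => r⁻¹ * k (y * r⁻¹) * f (x - y)) r
  rw [abs_of_pos (inv_pos.mpr hr), smul_eq_mul, ← integral_const_mul] at h2
  have h3 : ∀ z : ℝ, r⁻¹ * k (z * r * r⁻¹) * f (x - z * r) = r⁻¹ * (k z * f (x - z * r)) := by
    intro z
    rw [mul_assoc z, mul_inv_cancel₀ hr.ne', mul_one, mul_assoc]
  simp only [h3] at h2
  rw [integral_const_mul, integral_const_mul] at h2
  rw [h1]
  exact (mul_left_cancel₀ (inv_pos.mpr hr).ne' h2).symm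

theorem integral_G_mul (f : ℝ → ℝ) (x s : ℝ) {t : ℝ} (ht : 0 < t) :
    ∫ y : ℝ, G x y t * f y = spaceAvg phi (fun y _ => f y) x (t ^ (1 / 4 : ℝ)) s := by
  rw [spaceAvg, ← integral_rescaled_kernel_mul phi f x (rpow_pos_of_pos ht _)]
  simp only [G, rpow_neg ht.le]

theorem integral_Gyy_mul (h : ℝ → ℝ → ℝ) (x s : ℝ) {r : ℝ} (hr : 0 < r) :
    ∫ y : ℝ, Gyy x y r * h y s =
      r ^ (-(1 / 2) : ℝ) * spaceAvg (iteratedDeriv 2 phi) h x (r ^ (1 / 4 : ℝ)) s := by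
  rw [spaceAvg, ← integral_rescaled_kernel_mul _ (fun y => h y s) x (rpow_pos_of_pos hr _),
    ← integral_const_mul]
  congr 1
  ext y
  rw [Gyy, ← rpow_neg hr.le, ← mul_assoc, ← mul_assoc, ← rpow_add hr]
  norm_num

theorem integral_integral_Gyy_mul (h : ℝ → ℝ → ℝ) (x : ℝ) {t : ℝ} (ht : 0 < t) :
    ∫ s in (0 : ℝ)..t, ∫ y : ℝ, Gyy x y (t - s) * h y s =
      duhamel (iteratedDeriv 2 phi) h x t := by
  have h1 := intervalIntegral.integral_comp_sub_mul (a := 0) (b := 1)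
    (fun s => ∫ y : ℝ, Gyy x y (t - s) * h y s) ht.ne' t
  simp only [mul_one, mul_zero, sub_self, sub_zero, smul_eq_mul, sub_sub_cancel] at h1
  rw [eq_inv_mul_iff_mul_eq₀ ht.ne'] at h1
  rw [← h1, duhamel, ← intervalIntegral.integral_const_mul, ← intervalIntegral.integral_const_mul]
  refine intervalIntegral.integral_congr_ae (.of_forall fun σ hσ => ?_)
  rw [Set.uIoc_of_le zero_le_one] at hσ
  rw [integral_Gyy_mul h x _ (mul_pos ht hσ.1), mul_rpow ht.le hσ.1.le, ← mul_assoc, ← mul_assoc,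
    ← mul_assoc]
  congr 2
  rw [sqrt_eq_rpow, ← rpow_one_add' ht.le (by norm_num)]
  norm_num

section Estimates

variable {k : ℝ → ℝ} {h : ℝ → ℝ → ℝ} {C : ℝ}

theorem continuous_spaceAvg (hk : Integrable k) (hc : Continuous fun p : ℝ × ℝ => h p.1 p.2)
    (hb : ∀ y s, |h y s| ≤ C) :
    Continuous fun p : ℝ × ℝ × ℝ => spaceAvg k h p.1 p.2.1 p.2.2 := by
  unfold spaceAvg
  refine continuous_of_dominated (bound := fun z => |k z| * C) ?_ ?_ (hk.abs.mul_const C) ?_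
  · intro p
    exact hk.aestronglyMeasurable.mul (Continuous.aestronglyMeasurable
      (hc.comp (f := fun z => (p.1 - z * p.2.1, p.2.2)) (by fun_prop)))
  · intro p
    refine .of_forall fun z => ?_
    rw [norm_mul, norm_eq_abs, norm_eq_abs]
    exact mul_le_mul_of_nonneg_left (hb _ _) (abs_nonneg _)
  · refine .of_forall fun z => continuous_const.mul ?_
    exact hc.comp (f := fun p : ℝ × ℝ × ℝ => (p.1 - z * p.2.1, p.2.2)) (by fun_prop)

theorem abs_spaceAvg_le (hk : Integrable k) {s : ℝ} (hb : ∀ y, |h y s| ≤ C) (x r : ℝ) :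
    |spaceAvg k h x r s| ≤ (∫ z, |k z|) * C := by
  rw [spaceAvg, ← integral_mul_const, ← norm_eq_abs]
  refine norm_integral_le_of_norm_le (hk.abs.mul_const C) (.of_forall fun z => ?_)
  rw [norm_mul, norm_eq_abs, norm_eq_abs]
  exact mul_le_mul_of_nonneg_left (hb _) (abs_nonneg _)

theorem integrable_spaceAvg (hk : Integrable k) (hc : Continuous fun p : ℝ × ℝ => h p.1 p.2)
    (hb : ∀ y s, |h y s| ≤ C) (x r s : ℝ) :
    Integrable fun z => k z * h (x - z * r) s :=
  hk.mul_bdd (c := C) (Continuous.aestronglyMeasurable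
    (hc.comp (f := fun z => (x - z * r, s)) (by fun_prop))) (.of_forall fun _ => hb _ _)

theorem intervalIntegrable_rpow_neg_half :
    IntervalIntegrable (fun σ : ℝ => σ ^ (-(1 / 2) : ℝ)) volume 0 1 :=
  intervalIntegral.intervalIntegrable_rpow' (by norm_num)

theorem continuous_spaceAvg_duhamel (hk : Integrable k)
    (hc : Continuous fun p : ℝ × ℝ => h p.1 p.2) (hb : ∀ y s, |h y s| ≤ C) :
    Continuous fun p : (ℝ × ℝ) × ℝ =>
      spaceAvg k h p.1.1 ((p.1.2 * p.2) ^ (1 / 4 : ℝ)) (p.1.2 - p.1.2 * p.2) := by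
  have h1 : Continuous fun p : (ℝ × ℝ) × ℝ => (p.1.2 * p.2) ^ (1 / 4 : ℝ) :=
    (continuous_rpow_const (by norm_num)).comp (by fun_prop)
  exact (continuous_spaceAvg hk hc hb).comp (f := fun p : (ℝ × ℝ) × ℝ =>
    (p.1.1, (p.1.2 * p.2) ^ (1 / 4 : ℝ), p.1.2 - p.1.2 * p.2)) (by fun_prop)

theorem intervalIntegrable_duhamel (hk : Integrable k)
    (hc : Continuous fun p : ℝ × ℝ => h p.1 p.2) (hb : ∀ y s, |h y s| ≤ C) (x t : ℝ) :
    IntervalIntegrable (fun σ : ℝ =>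
      σ ^ (-(1 / 2) : ℝ) * spaceAvg k h x ((t * σ) ^ (1 / 4 : ℝ)) (t - t * σ)) volume 0 1 :=
  intervalIntegrable_rpow_neg_half.mul_continuousOn
    ((continuous_spaceAvg_duhamel hk hc hb).comp (f := fun σ => ((x, t), σ))
      (by fun_prop)).continuousOn

theorem continuous_duhamel (hk : Integrable k)
    (hc : Continuous fun p : ℝ × ℝ => h p.1 p.2) (hb : ∀ y s, |h y s| ≤ C) :
    Continuous fun p : ℝ × ℝ => duhamel k h p.1 p.2 := by
  unfold duhamel
  refine (continuous_sqrt.comp continuous_snd).mul ?_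
  refine intervalIntegral.continuous_of_dominated_interval
    (bound := fun σ => σ ^ (-(1 / 2) : ℝ) * ((∫ z, |k z|) * C)) ?_ ?_
    (intervalIntegrable_rpow_neg_half.mul_const _) ?_
  · intro p
    exact (intervalIntegrable_duhamel hk hc hb p.1 p.2).def'.aestronglyMeasurable
  · intro p
    refine .of_forall fun σ hσ => ?_
    rw [Set.uIoc_of_le zero_le_one] at hσ
    rw [norm_mul, norm_eq_abs, norm_eq_abs, abs_of_nonneg (rpow_nonneg hσ.1.le _)]
    exact mul_le_mul_of_nonneg_left (abs_spaceAvg_le hk (fun y => hb y _) _ _)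
      (rpow_nonneg hσ.1.le _)
  · refine .of_forall fun σ _ => continuous_const.mul ?_
    exact (continuous_spaceAvg_duhamel hk hc hb).comp (f := fun p => (p, σ)) (by fun_prop)

theorem duhamel_sub {h' : ℝ → ℝ → ℝ} {C' : ℝ} (hk : Integrable k)
    (hc : Continuous fun p : ℝ × ℝ => h p.1 p.2) (hb : ∀ y s, |h y s| ≤ C)
    (hc' : Continuous fun p : ℝ × ℝ => h' p.1 p.2) (hb' : ∀ y s, |h' y s| ≤ C') (x t : ℝ) :
    duhamel k h x t - duhamel k h' x t = duhamel k (fun y s => h y s - h' y s) x t := by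
  unfold duhamel
  rw [← mul_sub, ← intervalIntegral.integral_sub (intervalIntegrable_duhamel hk hc hb x t)
    (intervalIntegrable_duhamel hk hc' hb' x t)]
  congr 2
  ext σ
  rw [← mul_sub]
  congr 1
  unfold spaceAvg
  rw [← integral_sub (integrable_spaceAvg hk hc hb _ _ _) (integrable_spaceAvg hk hc' hb' _ _ _)]
  simp only [mul_sub]

theorem duhamel_congr {h' : ℝ → ℝ → ℝ} {t : ℝ} (ht : 0 ≤ t)
    (hh : ∀ y, ∀ s ∈ Set.Icc 0 t, h y s = h' y s) (x : ℝ) :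
    duhamel k h x t = duhamel k h' x t := by
  unfold duhamel spaceAvg
  congr 1
  refine intervalIntegral.integral_congr fun σ hσ => ?_
  rw [Set.uIcc_of_le zero_le_one] at hσ
  have hmem : t - t * σ ∈ Set.Icc 0 t := by
    constructor <;> nlinarith [hσ.1, hσ.2]
  simp only [hh _ _ hmem]

/-- A pointwise-in-`σ` bound on the source gives a bound on the Duhamel term. -/
theorem abs_duhamel_le_of_bound {t : ℝ} {b : ℝ → ℝ} {β : ℝ} (hk : Integrable k)
    (hβ : β < 1)
    (hh : ∀ σ ∈ Set.Ioc (0 : ℝ) 1, ∀ y,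
      |h y (t - t * σ)| ≤ b σ) (hbσ : ∀ σ ∈ Set.Ioc (0 : ℝ) 1,
        √t * (σ ^ (-(1 / 2) : ℝ) * b σ) ≤ C * σ ^ (-β)) (x : ℝ) :
    |duhamel k h x t| ≤ (∫ z, |k z|) * C / (1 - β) := by
  have hI : ∫ σ in (0 : ℝ)..1, (∫ z, |k z|) * C * σ ^ (-β) = (∫ z, |k z|) * C / (1 - β) := by
    rw [intervalIntegral.integral_const_mul, integral_rpow (Or.inl (by linarith)), one_rpow,
      zero_rpow (by linarith)]
    ring
  unfold duhamel
  rw [← intervalIntegral.integral_const_mul, ← hI, ← norm_eq_abs]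
  refine intervalIntegral.norm_integral_le_of_norm_le zero_le_one (.of_forall fun σ hσ => ?_)
    ((intervalIntegral.intervalIntegrable_rpow' (r := -β) (by linarith)).const_mul _)
  have hA : 0 ≤ ∫ z, |k z| := integral_nonneg fun z => abs_nonneg _
  rw [norm_mul, norm_mul, norm_eq_abs, norm_eq_abs, norm_eq_abs, abs_of_nonneg (sqrt_nonneg t),
    abs_of_nonneg (rpow_nonneg hσ.1.le _)]
  calc √t * (σ ^ (-(1 / 2) : ℝ) * |spaceAvg k h x ((t * σ) ^ (1 / 4 : ℝ)) (t - t * σ)|)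
      ≤ √t * (σ ^ (-(1 / 2) : ℝ) * ((∫ z, |k z|) * b σ)) := by
        have := rpow_nonneg hσ.1.le (-(1 / 2) : ℝ)
        gcongr
        exact abs_spaceAvg_le hk (hh σ hσ) _ _
    _ = (∫ z, |k z|) * (√t * (σ ^ (-(1 / 2) : ℝ) * b σ)) := by ring
    _ ≤ (∫ z, |k z|) * (C * σ ^ (-β)) := mul_le_mul_of_nonneg_left (hbσ σ hσ) hA
    _ = (∫ z, |k z|) * C * σ ^ (-β) := by ring

theorem abs_duhamel_le {t : ℝ} (ht : 0 ≤ t) (hk : Integrable k)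
    (hh : ∀ y, ∀ s ∈ Set.Icc 0 t, |h y s| ≤ C) (x : ℝ) :
    |duhamel k h x t| ≤ 2 * (∫ z, |k z|) * C * √t := by
  refine (abs_duhamel_le_of_bound (b := fun _ => C) (β := 1 / 2) (C := C * √t) hk (by norm_num)
    (fun σ hσ y => hh y _ ?_) (fun σ _ => le_of_eq (by ring)) x).trans (le_of_eq (by ring))
  constructor <;> nlinarith [hσ.1, hσ.2]

theorem exp_neg_le_rpow_neg_quarter {x : ℝ} (hx : 0 < x) : rexp (-x) ≤ x ^ (-(1 / 4) : ℝ) := by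
  rw [exp_neg, rpow_neg hx.le]
  refine inv_anti₀ (rpow_pos_of_pos hx _) ?_
  calc x ^ (1 / 4 : ℝ) ≤ (rexp x) ^ (1 / 4 : ℝ) := by
        gcongr
        linarith [add_one_le_exp x]
    _ = rexp (x * (1 / 4)) := (exp_mul x _).symm
    _ ≤ rexp x := exp_le_exp.mpr (by linarith)

theorem abs_duhamel_le_exp {t lam : ℝ} (ht : 0 ≤ t) (hlam : 0 < lam) (hC : 0 ≤ C)
    (hk : Integrable k) (hh : ∀ y, ∀ s ∈ Set.Icc 0 t, |h y s| ≤ C * rexp (lam * s)) (x : ℝ) :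
    |duhamel k h x t| ≤
      4 * (∫ z, |k z|) * C * t ^ (1 / 4 : ℝ) * lam ^ (-(1 / 4) : ℝ) * rexp (lam * t) := by
  rcases ht.eq_or_lt with rfl | ht'
  · simp [duhamel]
  refine (abs_duhamel_le_of_bound (b := fun σ => C * rexp (lam * (t - t * σ))) (β := 3 / 4)
    (C := C * t ^ (1 / 4 : ℝ) * lam ^ (-(1 / 4) : ℝ) * rexp (lam * t)) hk (by norm_num)
    (fun σ hσ y => hh y _ ?_) (fun σ hσ => ?_) x).trans (le_of_eq (by ring))
  · constructor <;> nlinarith [hσ.1, hσ.2]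
  · have h1 := exp_neg_le_rpow_neg_quarter (mul_pos (mul_pos hlam ht') hσ.1)
    rw [mul_rpow (by positivity) hσ.1.le, mul_rpow hlam.le ht] at h1
    have h2 : √t * t ^ (-(1 / 4) : ℝ) = t ^ (1 / 4 : ℝ) := by
      rw [sqrt_eq_rpow, ← rpow_add ht']
      norm_num
    have h3 : σ ^ (-(1 / 2) : ℝ) * σ ^ (-(1 / 4) : ℝ) = σ ^ (-(3 / 4) : ℝ) := by
      rw [← rpow_add hσ.1]
      norm_num
    have h4 : rexp (lam * (t - t * σ)) = rexp (lam * t) * rexp (-(lam * t * σ)) := by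
      rw [← exp_add]
      ring_nf
    have := rpow_nonneg hσ.1.le (-(1 / 2) : ℝ)
    calc √t * (σ ^ (-(1 / 2) : ℝ) * (C * rexp (lam * (t - t * σ))))
        ≤ √t * (σ ^ (-(1 / 2) : ℝ) * (C * (rexp (lam * t) *
          (lam ^ (-(1 / 4) : ℝ) * t ^ (-(1 / 4) : ℝ) * σ ^ (-(1 / 4) : ℝ))))) := by
          rw [h4]
          gcongr
      _ = C * (√t * t ^ (-(1 / 4) : ℝ)) * lam ^ (-(1 / 4) : ℝ) * rexp (lam * t) *
          (σ ^ (-(1 / 2) : ℝ) * σ ^ (-(1 / 4) : ℝ)) := by ring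
      _ = _ := by rw [h2, h3]

end Estimates

theorem continuous_Vp : Continuous Vp := by
  unfold Vp
  fun_prop

theorem abs_Vp_le {R a : ℝ} (ha : |a| ≤ R) : |Vp a| ≤ R ^ 3 + R := by
  have h3 : |a| ^ 3 ≤ R ^ 3 := pow_le_pow_left₀ (abs_nonneg a) ha 3
  calc |Vp a| ≤ |a ^ 3| + |a| := abs_sub _ _
    _ ≤ R ^ 3 + R := by rw [abs_pow]; exact add_le_add h3 ha

theorem abs_Vp_sub_le {R a b : ℝ} (ha : |a| ≤ R) (hb : |b| ≤ R) :
    |Vp a - Vp b| ≤ (3 * R ^ 2 + 1) * |a - b| := by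
  have h1 : Vp a - Vp b = (a ^ 2 + a * b + b ^ 2 - 1) * (a - b) := by
    unfold Vp
    ring
  rw [h1, abs_mul]
  refine mul_le_mul_of_nonneg_right ?_ (abs_nonneg _)
  obtain ⟨ha1, ha2⟩ := abs_le.mp ha
  obtain ⟨hb1, hb2⟩ := abs_le.mp hb
  have ha' : a ^ 2 ≤ R ^ 2 := sq_le_sq' ha1 ha2
  have hb' : b ^ 2 ≤ R ^ 2 := sq_le_sq' hb1 hb2
  rw [abs_le]
  constructor <;> nlinarith [sq_nonneg (a + b), sq_nonneg (a - b)]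

/-- The truncation of `a` to `[-R, R]`. -/
noncomputable def truncate (R a : ℝ) : ℝ := max (-R) (min a R)

theorem continuous_truncate (R : ℝ) : Continuous (truncate R) := by
  unfold truncate
  fun_prop

theorem abs_truncate_le {R : ℝ} (hR : 0 ≤ R) (a : ℝ) : |truncate R a| ≤ R :=
  abs_le.mpr ⟨le_max_left _ _, max_le (by linarith) (min_le_right _ _)⟩

theorem truncate_of_abs_le {R a : ℝ} (ha : |a| ≤ R) : truncate R a = a := by
  obtain ⟨h1, h2⟩ := abs_le.mp ha
  rw [truncate, min_eq_left h2, max_eq_right h1]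

theorem abs_truncate_sub_le (R a b : ℝ) : |truncate R a - truncate R b| ≤ |a - b| := by
  have h1 := abs_max_sub_max_le_abs (min a R) (min b R) (-R)
  have h2 := abs_min_sub_min_le_max a R b R
  rw [sub_self, abs_zero, max_eq_left (abs_nonneg _)] at h2
  rw [truncate, truncate, max_comm (-R), max_comm (-R)]
  exact h1.trans h2

/-- The right-hand side of the integral equation, in similarity variables. -/
noncomputable def mildRHS (u₀ : ℝ → ℝ) (q : ℝ → ℝ → ℝ) (h : ℝ → ℝ → ℝ) (x t : ℝ) : ℝ :=
  spaceAvg phi (fun y _ => u₀ y) x (t ^ (1 / 4 : ℝ)) 0 +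
    duhamel (iteratedDeriv 2 phi) h x t + q x t

theorem mildRHS_eq (u₀ : ℝ → ℝ) (q h : ℝ → ℝ → ℝ) (x : ℝ) {t : ℝ} (ht : 0 < t) :
    (∫ y : ℝ, G x y t * u₀ y) + (∫ s in (0 : ℝ)..t, ∫ y : ℝ, Gyy x y (t - s) * h y s) + q x t =
      mildRHS u₀ q h x t := by
  rw [mildRHS, integral_integral_Gyy_mul h x ht, integral_G_mul u₀ x 0 ht]

section Solutions

variable {u₀ : ℝ → ℝ} {q h : ℝ → ℝ → ℝ} {M C T : ℝ}

theorem continuous_mildRHS (hu₀ : Continuous u₀) (hu₀M : ∀ x, |u₀ x| ≤ M)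
    (hq : Continuous fun p : ℝ × ℝ => q p.1 p.2)
    (hc : Continuous fun p : ℝ × ℝ => h p.1 p.2) (hb : ∀ y s, |h y s| ≤ C) :
    Continuous fun p : ℝ × ℝ => mildRHS u₀ q h p.1 p.2 := by
  have h1 : Continuous fun p : ℝ × ℝ => p.2 ^ (1 / 4 : ℝ) :=
    (continuous_rpow_const (by norm_num)).comp continuous_snd
  have h2 := (continuous_spaceAvg (h := fun y _ => u₀ y) integrable_phi (by fun_prop)
    (fun y _ => hu₀M y)).comp (f := fun p : ℝ × ℝ => (p.1, p.2 ^ (1 / 4 : ℝ), (0 : ℝ)))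
    (by fun_prop)
  exact (h2.add (continuous_duhamel integrable_iteratedDeriv_two_phi hc hb)).add hq

theorem abs_mildRHS_le {t : ℝ} (ht : 0 ≤ t) (hu₀M : ∀ x, |u₀ x| ≤ M)
    (hqM : ∀ x t, |q x t| ≤ M) (hb : ∀ y s, |h y s| ≤ C) (x : ℝ) :
    |mildRHS u₀ q h x t| ≤
      (∫ z, |phi z|) * M + 2 * (∫ z, |iteratedDeriv 2 phi z|) * C * √t + M := by
  refine (abs_add_le _ _).trans (add_le_add ((abs_add_le _ _).trans (add_le_add ?_ ?_)) (hqM x t))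
  · exact abs_spaceAvg_le integrable_phi hu₀M _ _
  · exact abs_duhamel_le ht integrable_iteratedDeriv_two_phi (fun y s _ => hb y s) x

theorem mildRHS_sub {h' : ℝ → ℝ → ℝ} {C' : ℝ}
    (hc : Continuous fun p : ℝ × ℝ => h p.1 p.2) (hb : ∀ y s, |h y s| ≤ C)
    (hc' : Continuous fun p : ℝ × ℝ => h' p.1 p.2) (hb' : ∀ y s, |h' y s| ≤ C') (x t : ℝ) :
    mildRHS u₀ q h x t - mildRHS u₀ q h' x t =
      duhamel (iteratedDeriv 2 phi) (fun y s => h y s - h' y s) x t := by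
  rw [← duhamel_sub integrable_iteratedDeriv_two_phi hc hb hc' hb', mildRHS, mildRHS]
  ring

theorem isMildSolution_of_eq_mildRHS {w : ℝ → ℝ → ℝ} {K : ℝ}
    (hc : Continuous fun p : ℝ × ℝ => w p.1 p.2) (hK : ∀ x t, |w x t| ≤ K)
    (hw : ∀ x, ∀ t ∈ Set.Icc 0 T, w x t = mildRHS u₀ q (fun y s => Vp (w y s)) x t) :
    IsMildSolution T u₀ q w :=
  ⟨hc.continuousOn, ⟨K, fun x t _ => hK x t⟩, fun x t ht => by
    rw [hw x t (Set.Ioc_subset_Icc_self ht), mildRHS_eq _ _ _ _ ht.1]⟩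

/-- A mild solution on `[0, T]` extends to a globally continuous bounded function satisfying the
integral equation up to time `0`. -/
theorem IsMildSolution.exists_extension (hT : 0 < T) (hu₀ : Continuous u₀)
    (hu₀M : ∀ x, |u₀ x| ≤ M) (hq : Continuous fun p : ℝ × ℝ => q p.1 p.2) {v : ℝ → ℝ → ℝ}
    (hv : IsMildSolution T u₀ q v) :
    ∃ w : ℝ → ℝ → ℝ, Continuous (fun p : ℝ × ℝ => w p.1 p.2) ∧
      (∃ K, ∀ x t, |w x t| ≤ K) ∧ (∀ x, ∀ t ∈ Set.Icc 0 T, w x t = v x t) ∧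
      ∀ x, ∀ t ∈ Set.Icc 0 T, w x t = mildRHS u₀ q (fun y s => Vp (w y s)) x t := by
  obtain ⟨hvc, ⟨K, hK⟩, hveq⟩ := hv
  set w : ℝ → ℝ → ℝ := fun x t => v x (max 0 (min t T)) with hw
  have hmem : ∀ t, max 0 (min t T) ∈ Set.Icc 0 T := fun t =>
    ⟨le_max_left _ _, max_le hT.le (min_le_right _ _)⟩
  have hwv : ∀ x, ∀ t ∈ Set.Icc 0 T, w x t = v x t := fun x t ht => by
    simp only [hw, min_eq_left ht.2, max_eq_right ht.1]
  have hwc : Continuous fun p : ℝ × ℝ => w p.1 p.2 :=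
    hvc.comp_continuous (f := fun p : ℝ × ℝ => (p.1, max 0 (min p.2 T))) (by fun_prop)
      fun p => ⟨Set.mem_univ _, hmem _⟩
  have hwK : ∀ x t, |w x t| ≤ K := fun x t => hK x _ (hmem t)
  refine ⟨w, hwc, ⟨K, hwK⟩, hwv, fun x => ?_⟩
  have hR := continuous_mildRHS hu₀ hu₀M hq (h := fun y s => Vp (w y s))
    (continuous_Vp.comp hwc) (fun y s => abs_Vp_le (hwK y s))
  have heq : Set.EqOn (fun t => w x t) (fun t => mildRHS u₀ q (fun y s => Vp (w y s)) x t)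
      (Set.Ioc 0 T) := by
    intro t ht
    simp only
    rw [hwv x t (Set.Ioc_subset_Icc_self ht), hveq x t ht, ← mildRHS_eq _ _ _ _ ht.1]
    congr 2
    refine intervalIntegral.integral_congr fun s hs => ?_
    rw [Set.uIcc_of_le ht.1.le] at hs
    simp only [hwv _ s ⟨hs.1, hs.2.trans ht.2⟩]
  have := heq.closure (hwc.comp (f := fun t => (x, t)) (by fun_prop))
    (hR.comp (f := fun t => (x, t)) (by fun_prop))
  rwa [closure_Ioc hT.ne] at this

theorem eq_of_eq_mildRHS (hT : 0 ≤ T) {v w : ℝ → ℝ → ℝ} {K : ℝ}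
    (hvc : Continuous fun p : ℝ × ℝ => v p.1 p.2) (hvK : ∀ x t, |v x t| ≤ K)
    (hv : ∀ x, ∀ t ∈ Set.Icc 0 T, v x t = mildRHS u₀ q (fun y s => Vp (v y s)) x t)
    (hwc : Continuous fun p : ℝ × ℝ => w p.1 p.2) (hwK : ∀ x t, |w x t| ≤ K)
    (hw : ∀ x, ∀ t ∈ Set.Icc 0 T, w x t = mildRHS u₀ q (fun y s => Vp (w y s)) x t)
    (x t : ℝ) (ht : t ∈ Set.Icc 0 T) : v x t = w x t := by
  have hK0 : 0 ≤ K := (abs_nonneg _).trans (hvK 0 0)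
  set B : ℝ := ∫ z, |iteratedDeriv 2 phi z|
  have hB0 : 0 ≤ B := integral_nonneg fun z => abs_nonneg _
  set L : ℝ := 3 * K ^ 2 + 1
  have hL0 : 0 < L := by positivity
  set A : ℝ := 8 * B * L * T ^ (1 / 4 : ℝ) + 1 with hA
  have hTr : 0 ≤ T ^ (1 / 4 : ℝ) := rpow_nonneg hT _
  have hA0 : 0 < A := by positivity
  have hlam : (A ^ 4) ^ (-(1 / 4) : ℝ) = A⁻¹ := by
    rw [← rpow_natCast, ← rpow_mul hA0.le]
    norm_num [rpow_neg_one]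
  have step : ∀ C : ℝ, 0 ≤ C →
      (∀ y, ∀ s ∈ Set.Icc 0 T, |v y s - w y s| ≤ C * rexp (A ^ 4 * s)) →
      ∀ y, ∀ s ∈ Set.Icc 0 T, |v y s - w y s| ≤ C / 2 * rexp (A ^ 4 * s) := by
    intro C hC hCb y s hs
    rw [hv y s hs, hw y s hs, mildRHS_sub (h := fun y s => Vp (v y s)) (continuous_Vp.comp hvc)
      (fun y s => abs_Vp_le (hvK y s)) (continuous_Vp.comp hwc) (fun y s => abs_Vp_le (hwK y s))]
    refine (abs_duhamel_le_exp (C := L * C) hs.1 (pow_pos hA0 4) (by positivity)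
      integrable_iteratedDeriv_two_phi (fun z r hr => ?_) y).trans ?_
    · rw [mul_assoc]
      exact (abs_Vp_sub_le (hvK z r) (hwK z r)).trans
        (mul_le_mul_of_nonneg_left (hCb z r ⟨hr.1, hr.2.trans hs.2⟩) hL0.le)
    · refine mul_le_mul_of_nonneg_right ?_ (exp_pos _).le
      have hsT : s ^ (1 / 4 : ℝ) ≤ T ^ (1 / 4 : ℝ) := rpow_le_rpow hs.1 hs.2 (by norm_num)
      rw [hlam, ← div_eq_mul_inv, div_le_iff₀ hA0]
      calc 4 * B * (L * C) * s ^ (1 / 4 : ℝ) ≤ 4 * B * (L * C) * T ^ (1 / 4 : ℝ) := by gcongr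
        _ ≤ C / 2 * A := by rw [hA]; linarith
  have iter : ∀ n : ℕ, ∀ y, ∀ s ∈ Set.Icc 0 T,
      |v y s - w y s| ≤ 2 * K * (1 / 2) ^ n * rexp (A ^ 4 * s) := by
    intro n
    induction n with
    | zero =>
      intro y s hs
      have h1 : 1 ≤ rexp (A ^ 4 * s) := one_le_exp (mul_nonneg (by positivity) hs.1)
      have h2 : |v y s - w y s| ≤ 2 * K := by
        linarith [abs_sub (v y s) (w y s), hvK y s, hwK y s]
      rw [pow_zero, mul_one]
      exact h2.trans (le_mul_of_one_le_right (by positivity) h1)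
    | succ n ih =>
      intro y s hs
      exact (step _ (by positivity) ih y s hs).trans (le_of_eq (by ring))
  have hlim : Filter.Tendsto (fun n : ℕ => 2 * K * (1 / 2 : ℝ) ^ n * rexp (A ^ 4 * t))
      Filter.atTop (nhds 0) := by
    have := (tendsto_pow_atTop_nhds_zero_of_lt_one (r := (1 / 2 : ℝ)) (by norm_num)
      (by norm_num)).const_mul (2 * K)
    simpa using this.mul_const (rexp (A ^ 4 * t))
  have := ge_of_tendsto' hlim fun n => iter n x t ht
  exact sub_eq_zero.mp (abs_nonpos_iff.mp this)

open scoped BoundedContinuousFunction in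
/-- If `T` is small enough, the integral equation has a global continuous bounded extension of a
solution on `[0, T]`. -/
theorem exists_eq_mildRHS {R : ℝ} (hR : 0 ≤ R) (hT : 0 ≤ T)
    (hu₀ : Continuous u₀) (hu₀M : ∀ x, |u₀ x| ≤ M)
    (hq : Continuous fun p : ℝ × ℝ => q p.1 p.2) (hqM : ∀ x t, |q x t| ≤ M)
    (hself : (∫ z, |phi z|) * M + 2 * (∫ z, |iteratedDeriv 2 phi z|) * (R ^ 3 + R) * √T + M ≤ R)
    (hcontr : 2 * (∫ z, |iteratedDeriv 2 phi z|) * (3 * R ^ 2 + 1) * √T ≤ 1 / 2) :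
    ∃ w : ℝ → ℝ → ℝ, Continuous (fun p : ℝ × ℝ => w p.1 p.2) ∧ (∀ x t, |w x t| ≤ R) ∧
      ∀ x, ∀ t ∈ Set.Icc 0 T, w x t = mildRHS u₀ q (fun y s => Vp (w y s)) x t := by
  have hB0 : 0 ≤ ∫ z, |iteratedDeriv 2 phi z| := integral_nonneg fun z => abs_nonneg _
  let src (w : (ℝ × ℝ) →ᵇ ℝ) (y s : ℝ) : ℝ := Vp (truncate R (w (y, s)))
  let clamp (t : ℝ) : ℝ := max 0 (min t T)
  have hclamp0 (t : ℝ) : 0 ≤ clamp t := le_max_left _ _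
  have hclampT (t : ℝ) : clamp t ≤ T := max_le hT (min_le_right _ _)
  have hsrcc (w : (ℝ × ℝ) →ᵇ ℝ) : Continuous fun p : ℝ × ℝ => src w p.1 p.2 :=
    continuous_Vp.comp ((continuous_truncate R).comp w.continuous)
  have hsrcb (w : (ℝ × ℝ) →ᵇ ℝ) (y s : ℝ) : |src w y s| ≤ R ^ 3 + R :=
    abs_Vp_le (abs_truncate_le hR _)
  have hbound (w : (ℝ × ℝ) →ᵇ ℝ) (x t : ℝ) : |mildRHS u₀ q (src w) x (clamp t)| ≤ R := by
    refine (abs_mildRHS_le (hclamp0 t) hu₀M hqM (hsrcb w) x).trans (le_trans ?_ hself)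
    gcongr
    exact hclampT t
  let Ψ (w : (ℝ × ℝ) →ᵇ ℝ) : (ℝ × ℝ) →ᵇ ℝ :=
    BoundedContinuousFunction.ofNormedAddCommGroup
      (fun p : ℝ × ℝ => mildRHS u₀ q (src w) p.1 (clamp p.2))
      ((continuous_mildRHS hu₀ hu₀M hq (hsrcc w) (hsrcb w)).comp
        (f := fun p : ℝ × ℝ => (p.1, clamp p.2)) (by fun_prop)) R
      (fun p => hbound w p.1 p.2)
  have hΨ : ContractingWith (1 / 2) Ψ := by
    refine ⟨by norm_num, LipschitzWith.of_dist_le_mul fun w w' => ?_⟩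
    rw [BoundedContinuousFunction.dist_le (by positivity)]
    intro p
    change |mildRHS u₀ q (src w) p.1 (clamp p.2) - mildRHS u₀ q (src w') p.1 (clamp p.2)| ≤ _
    rw [mildRHS_sub (hsrcc w) (hsrcb w) (hsrcc w') (hsrcb w')]
    refine (abs_duhamel_le (C := (3 * R ^ 2 + 1) * dist w w') (hclamp0 p.2)
      integrable_iteratedDeriv_two_phi (fun y s _ => ?_) p.1).trans ?_
    · refine (abs_Vp_sub_le (abs_truncate_le hR _) (abs_truncate_le hR _)).trans
        (mul_le_mul_of_nonneg_left ?_ (by positivity))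
      exact (abs_truncate_sub_le R _ _).trans (w.dist_coe_le_dist (g := w') (y, s))
    · calc _ ≤ 2 * (∫ z, |iteratedDeriv 2 phi z|) * ((3 * R ^ 2 + 1) * dist w w') * √T := by
            gcongr
            exact hclampT p.2
        _ = 2 * (∫ z, |iteratedDeriv 2 phi z|) * (3 * R ^ 2 + 1) * √T * dist w w' := by ring
        _ ≤ 1 / 2 * dist w w' := mul_le_mul_of_nonneg_right hcontr dist_nonneg
        _ = _ := by norm_num
  set w := ContractingWith.fixedPoint Ψ hΨ
  have hfix (x t : ℝ) : w (x, t) = mildRHS u₀ q (src w) x (clamp t) :=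
    (congrArg (fun f : (ℝ × ℝ) →ᵇ ℝ => f (x, t)) hΨ.fixedPoint_isFixedPt).symm
  have hwR (x t : ℝ) : |w (x, t)| ≤ R := hfix x t ▸ hbound w x t
  have hsrc : src w = fun y s => Vp (w (y, s)) := by
    ext y s
    simp only [src, truncate_of_abs_le (hwR y s)]
  refine ⟨fun x t => w (x, t), w.continuous, hwR, fun x t ht => ?_⟩
  beta_reduce
  have hct : clamp t = t := by simp only [clamp, min_eq_left ht.2, max_eq_right ht.1]
  rw [← hsrc, hfix, hct]

end Solutions

/-- Local existence and uniqueness: for bounded data there is `T₀ > 0`, depending only on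
the sup-norm bound `M` of `u₀` and `q`, such that the Cahn–Hilliard integral equation has
a unique continuous bounded solution on `ℝ × [0,T₀]`. -/
theorem local_existence_uniqueness (M : ℝ) (hM : 0 < M) :
    ∃ T₀ > (0 : ℝ),
      ∀ u₀ : ℝ → ℝ, Continuous u₀ → (∀ x, |u₀ x| ≤ M) →
      ∀ q : ℝ → ℝ → ℝ, Continuous (fun p : ℝ × ℝ => q p.1 p.2) → (∀ x t, |q x t| ≤ M) →
        ∃ u : ℝ → ℝ → ℝ, IsMildSolution T₀ u₀ q u ∧
          ∀ v : ℝ → ℝ → ℝ, IsMildSolution T₀ u₀ q v →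
            ∀ x : ℝ, ∀ t ∈ Set.Icc (0 : ℝ) T₀, v x t = u x t := by
  set A : ℝ := ∫ z, |phi z|
  set B : ℝ := ∫ z, |iteratedDeriv 2 phi z|
  have hA0 : 0 ≤ A := integral_nonneg fun z => abs_nonneg _
  have hB0 : 0 ≤ B := integral_nonneg fun z => abs_nonneg _
  set R : ℝ := A * M + M + 1
  have hR : 0 ≤ R := by positivity
  set D : ℝ := 2 * B * (R ^ 3 + R) + 4 * B * (3 * R ^ 2 + 1) + 1
  have hD0 : 0 < D := by positivity
  have hsqrt : √((D⁻¹) ^ 2) = D⁻¹ := sqrt_sq (by positivity)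
  refine ⟨(D⁻¹) ^ 2, by positivity, fun u₀ hu₀ hu₀M q hq hqM => ?_⟩
  have hT : 0 < (D⁻¹) ^ 2 := by positivity
  have h1 : 0 ≤ B * (R ^ 3 + R) := by positivity
  have h2 : 0 ≤ B * (3 * R ^ 2 + 1) := by positivity
  have hself : A * M + 2 * B * (R ^ 3 + R) * √((D⁻¹) ^ 2) + M ≤ R := by
    have : 2 * B * (R ^ 3 + R) * D⁻¹ ≤ 1 := by
      rw [← div_eq_mul_inv, div_le_one hD0]
      linarith
    rw [hsqrt]
    linarith
  have hcontr : 2 * B * (3 * R ^ 2 + 1) * √((D⁻¹) ^ 2) ≤ 1 / 2 := by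
    rw [hsqrt, ← div_eq_mul_inv, div_le_iff₀ hD0]
    linarith
  obtain ⟨u, huc, huR, hu⟩ := exists_eq_mildRHS hR hT.le hu₀ hu₀M hq hqM hself hcontr
  refine ⟨u, isMildSolution_of_eq_mildRHS huc huR hu, fun v hv x t ht => ?_⟩
  obtain ⟨w, hwc, ⟨K, hK⟩, hwv, hw⟩ := hv.exists_extension hT hu₀ hu₀M hq
  rw [← hwv x t ht]
  exact eq_of_eq_mildRHS hT.le hwc (fun y s => (hK y s).trans (le_max_left K R)) hw huc
    (fun y s => (huR y s).trans (le_max_right K R)) hu x t ht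
end

section
/- For all t ≥ t' > 0, ∫₀^{t'} ds ∫_ℝ dy ( e^{−y²/(2(t−s))} / √(2π(t−s)) ) · ( e^{−y²/(2(t'−s))} / √(2π(t'−s)) ) = (1/√(2π)) ( √(t+t') − √(t−t') ). Consequently, if h(x,t) = ∫₀^t ∫ ( e^{−(x−y)²/(2(t−s))} / √(2π(t−s)) ) dW_{y,s} is the solution of the stochastic heat equation ∂_t h = (1/2)∂_x² h + Ẇ with h(·,0) = 0, then E( h(0,t) h(0,t') ) = (1/√(2π)) ( √(t+t') − √(t−t') ). -/
open MeasureTheory Real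

/-- The deterministic double integral giving the covariance `E(h(0,t) h(0,t'))` of the
stochastic convolution of the heat kernel against space-time white noise. -/
noncomputable def heatCov (t t' : ℝ) : ℝ :=
  ∫ s in (0 : ℝ)..t', ∫ y : ℝ,
    (Real.exp (-(y ^ 2) / (2 * (t - s))) / Real.sqrt (2 * Real.pi * (t - s))) *
      (Real.exp (-(y ^ 2) / (2 * (t' - s))) / Real.sqrt (2 * Real.pi * (t' - s)))

/-- The `L²` pairing of two centered Gaussian densities of variances `a` and `b`. -/
theorem integral_gaussian_mul_gaussian {a b : ℝ} (ha : 0 < a) (hb : 0 < b) :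
    ∫ y : ℝ, (Real.exp (-(y ^ 2) / (2 * a)) / Real.sqrt (2 * Real.pi * a)) *
        (Real.exp (-(y ^ 2) / (2 * b)) / Real.sqrt (2 * Real.pi * b)) =
      1 / Real.sqrt (2 * Real.pi * (a + b)) := by
  have hπ := Real.pi_pos
  have hfun : ∀ y : ℝ, (Real.exp (-(y ^ 2) / (2 * a)) / Real.sqrt (2 * Real.pi * a)) *
        (Real.exp (-(y ^ 2) / (2 * b)) / Real.sqrt (2 * Real.pi * b)) =
      Real.exp (-((a + b) / (2 * a * b)) * y ^ 2) *
        (Real.sqrt (2 * Real.pi * a) * Real.sqrt (2 * Real.pi * b))⁻¹ := by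
    intro y
    rw [div_mul_div_comm, ← Real.exp_add, div_eq_mul_inv]
    congr 2
    field_simp
    ring
  simp_rw [hfun]
  rw [integral_mul_const, integral_gaussian, ← Real.sqrt_mul (by positivity), ← Real.sqrt_inv,
    ← Real.sqrt_mul (by positivity), one_div, ← Real.sqrt_inv]
  congr 1
  field_simp

/-- The covariance integral in closed form. -/
theorem heatCov_eq {t t' : ℝ} (ht' : 0 < t') (htt' : t' ≤ t) :
    heatCov t t' =
      (1 / Real.sqrt (2 * Real.pi)) * (Real.sqrt (t + t') - Real.sqrt (t - t')) := by
  have hcont : ContinuousOn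
      (fun s : ℝ => -(1 / Real.sqrt (2 * Real.pi)) * Real.sqrt (t + t' - 2 * s))
      (Set.Icc 0 t') := by fun_prop
  have hderiv : ∀ s ∈ Set.Ioo 0 t', HasDerivAt
      (fun s : ℝ => -(1 / Real.sqrt (2 * Real.pi)) * Real.sqrt (t + t' - 2 * s))
      (∫ y : ℝ, (Real.exp (-(y ^ 2) / (2 * (t - s))) / Real.sqrt (2 * Real.pi * (t - s))) *
        (Real.exp (-(y ^ 2) / (2 * (t' - s))) / Real.sqrt (2 * Real.pi * (t' - s)))) s := by
    rintro s ⟨-, hs⟩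
    have hpos : 0 < t + t' - 2 * s := by linarith
    rw [integral_gaussian_mul_gaussian (by linarith) (by linarith)]
    have hlin : HasDerivAt (fun s : ℝ => t + t' - 2 * s) (-2) s := by
      simpa using ((hasDerivAt_id s).const_mul 2).const_sub (t + t')
    refine ((hlin.sqrt hpos.ne').const_mul (-(1 / Real.sqrt (2 * Real.pi)))).congr_deriv ?_
    rw [show t - s + (t' - s) = t + t' - 2 * s by ring,
      Real.sqrt_mul (x := 2 * Real.pi) (by positivity) (t + t' - 2 * s)]
    have := Real.sqrt_pos.2 hpos
    field_simp
  have hnonneg : ∀ s ∈ Set.Ioo 0 t', 0 ≤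
      ∫ y : ℝ, (Real.exp (-(y ^ 2) / (2 * (t - s))) / Real.sqrt (2 * Real.pi * (t - s))) *
        (Real.exp (-(y ^ 2) / (2 * (t' - s))) / Real.sqrt (2 * Real.pi * (t' - s))) :=
    fun s _ => integral_nonneg fun y => by positivity
  have hint := (intervalIntegrable_iff_integrableOn_Ioc_of_le ht'.le).2
    (intervalIntegral.integrableOn_deriv_of_nonneg hcont hderiv hnonneg)
  rw [heatCov, intervalIntegral.integral_eq_sub_of_hasDerivAt_of_le ht'.le hcont hderiv hint,
    show t + t' - 2 * t' = t - t' by ring, mul_zero, sub_zero]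
  ring

/-- For `t ≥ t' > 0`,
`∫₀^{t'} ds ∫_ℝ dy (e^{−y²/(2(t−s))}/√(2π(t−s))) (e^{−y²/(2(t'−s))}/√(2π(t'−s)))
 = (1/√(2π)) (√(t+t') − √(t−t'))`.
Consequently any process `h(0,·)` whose covariance is given by this double integral (as is
the solution of the stochastic heat equation with zero initial condition, by the Itô
isometry) satisfies `E(h(0,t) h(0,t')) = (1/√(2π))(√(t+t') − √(t−t'))`. -/
theorem heat_kernel_covariance :
    (∀ t t' : ℝ, 0 < t' → t' ≤ t →
      heatCov t t' = (1 / Real.sqrt (2 * Real.pi)) * (Real.sqrt (t + t') - Real.sqrt (t - t'))) ∧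
    (∀ (Ω : Type) [MeasureSpace Ω] [IsProbabilityMeasure (volume : Measure Ω)]
        (h : ℝ → Ω → ℝ),
      (∀ t t' : ℝ, 0 < t' → t' ≤ t → (∫ ω : Ω, h t ω * h t' ω) = heatCov t t') →
      ∀ t t' : ℝ, 0 < t' → t' ≤ t →
        (∫ ω : Ω, h t ω * h t' ω)
          = (1 / Real.sqrt (2 * Real.pi)) * (Real.sqrt (t + t') - Real.sqrt (t - t'))) := by
  exact ⟨fun _ _ ht' htt' => heatCov_eq ht' htt',
    fun _ _ _ _ hcov t t' ht' htt' => (hcov t t' ht' htt').trans (heatCov_eq ht' htt')⟩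
end
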